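/- arXiv:1201.2350 — 2 statements merged into one kernel-verified Lean document; each statement's English description precedes it below -/
import Mathlib

section
/- Suppose F : K → L²(Ω) is pointwise linearly bounded and uniformly continuous. Then for every (X̄, V̄) ∈ K × L²(Ω) there exists a Lagrangian solution X with initial data (X̄, V̄). Moreover, for every T ≥ 0 there exists a constant C_T ≥ 0 such that every Lagrangian solution X with derivative V = Ẋ (defined a.e.) satisfies ‖X(t)‖_{L²(Ω)} + ‖V(t)‖_{L²(Ω)} ≤ C_T ( 1 + ‖X̄‖_{L²(Ω)} + ‖V̄‖_{L²(Ω)} ) for a.e. t ∈ [0,T]; and if ψ is an admissible doubling integrand with exponent q ≥ 1, there exists a constant C_{q,T} ≥ 0 such that Ψ[X(t)] + Ψ[V(t)] ≤ C_{q,T} ( 1 + Ψ[X̄] + Ψ[V̄] ) for a.e. t ∈ [0,T]. -/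
open MeasureTheory Set Filter
open scoped ENNReal NNReal RealInnerProductSpace

noncomputable section

/-- The interval `Ω = (0,1)`. -/
def Omg : Set ℝ := Set.Ioo 0 1

/-- Lebesgue measure restricted to `(0,1)`. -/
def mu : Measure ℝ := volume.restrict Omg

/-- The Hilbert space `L²(Ω)`. -/
abbrev L2 : Type := Lp ℝ 2 mu

/-- The cone `K` of functions in `L²(Ω)` admitting a nondecreasing representative. -/
def Kcone : Set L2 := {X | ∃ g : ℝ → ℝ, MonotoneOn g Omg ∧ ⇑X =ᵐ[mu] g}

/-- The normal cone to `K` at `X`. -/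
def normalCone (X : L2) : Set L2 := {W | ∀ Y ∈ Kcone, ⟪W, Y - X⟫ ≤ 0}

/-- `F` is pointwise linearly bounded:
`|F[X](m)| ≤ C_p (1 + |X(m)| + ‖X‖_{L¹})` a.e., for all `X ∈ K`. -/
def PtwLinBdd (F : L2 → L2) (Cp : ℝ) : Prop :=
  0 ≤ Cp ∧ ∀ X ∈ Kcone, ∀ᵐ m ∂mu, |F X m| ≤ Cp * (1 + |X m| + ∫ m', |X m'| ∂mu)

/-- `F` is uniformly continuous on `K`. -/
def UnifCont (F : L2 → L2) : Prop :=
  (∃ C : ℝ, 0 ≤ C ∧ ∀ X ∈ Kcone, ‖F X‖ ≤ C * (1 + ‖X‖)) ∧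
  (∃ ω : ℝ → ℝ, ContinuousOn ω (Set.Ici 0) ∧ ConcaveOn ℝ (Set.Ici 0) ω ∧
    (∀ r : ℝ, 0 ≤ r → 0 ≤ ω r) ∧ ω 0 = 0 ∧ (∀ r : ℝ, 0 < r → 0 < ω r) ∧
    ∀ X₁ ∈ Kcone, ∀ X₂ ∈ Kcone, ‖F X₁ - F X₂‖ ≤ ω ‖X₁ - X₂‖)

/-- An admissible doubling integrand with exponent `q`: even, convex, `C¹`, `ψ(0)=0` and
`ψ(λ r) ≤ λ^q ψ(r)` for all `r` and `λ ≥ 1`, where `q ≥ 1`. -/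
def AdmissibleDoubling (ψ : ℝ → ℝ) (q : ℝ) : Prop :=
  (∀ r : ℝ, 0 ≤ ψ r) ∧ (∀ r : ℝ, ψ (-r) = ψ r) ∧ ConvexOn ℝ Set.univ ψ ∧
  ContDiff ℝ 1 ψ ∧ ψ 0 = 0 ∧ 1 ≤ q ∧ ∀ r l : ℝ, 1 ≤ l → ψ (l * r) ≤ l ^ q * ψ r

/-- The integral functional `Ψ[X] = ∫₀¹ ψ(X(m)) dm` (valued in `[0,∞]`). -/
def PsiL (ψ : ℝ → ℝ) (X : L2) : ℝ≥0∞ := ∫⁻ m, ENNReal.ofReal (ψ (X m)) ∂mu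

/-- A Lagrangian solution with initial data `(X̄, V̄)`. -/
def LagSol (F : L2 → L2) (Xbar Vbar : L2) (X : ℝ → L2) : Prop :=
  (∀ t : ℝ, 0 ≤ t → X t ∈ Kcone) ∧ X 0 = Xbar ∧
  (∀ T : ℝ, ∃ L : ℝ≥0, LipschitzOnWith L X (Set.Icc 0 T)) ∧
  (∀ᵐ t ∂(volume.restrict (Set.Ioi (0:ℝ))),
    ∃ V : L2, HasDerivAt X V t ∧
      (Vbar + ∫ s in Set.Ioc (0:ℝ) t, F (X s)) - V ∈ normalCone (X t))

open scoped Topology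

/-- An orthonormal family in a separable Hilbert space is countable. -/
theorem countable_of_orthonormal {H ι : Type*} [NormedAddCommGroup H] [InnerProductSpace ℝ H]
    [SecondCountableTopology H] {v : ι → H} (hv : Orthonormal ℝ v) : Countable ι := by
  have hdist : ∀ i j, i ≠ j → 1 < dist (v i) (v j) := by
    intro i j hij
    have h := norm_sub_sq_real (v i) (v j)
    rw [hv.1 i, hv.1 j, hv.2 hij] at h
    rw [dist_eq_norm]
    nlinarith [norm_nonneg (v i - v j)]
  have hd : (univ : Set ι).PairwiseDisjoint fun i => Metric.ball (v i) (1 / 2) := by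
    intro i _ j _ hij
    refine Metric.ball_disjoint_ball ?_
    linarith [hdist i j hij]
  have hc := hd.countable_of_isOpen (fun i _ => Metric.isOpen_ball)
    (fun i _ => ⟨v i, Metric.mem_ball_self (by norm_num)⟩)
  exact countable_univ_iff.mp hc

/-- A Lipschitz curve in a separable Hilbert space is differentiable almost everywhere. -/
theorem LipschitzWith.ae_differentiableAt_of_hilbert {H : Type*} [NormedAddCommGroup H]
    [InnerProductSpace ℝ H] [CompleteSpace H] [SecondCountableTopology H] {L : ℝ≥0}
    {f : ℝ → H} (hf : LipschitzWith L f) : ∀ᵐ t, DifferentiableAt ℝ f t := by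
  obtain ⟨w, b, -⟩ := exists_hilbertBasis ℝ H
  have hcount : Countable w := countable_of_orthonormal b.orthonormal
  set c : w → ℝ → ℝ := fun i t => ⟪b i, f t⟫ with hc
  have hcL : ∀ i, LipschitzWith L (c i) := by
    intro i
    refine LipschitzWith.of_dist_le_mul fun s t => ?_
    rw [Real.dist_eq, hc]
    simp only
    rw [← inner_sub_right]
    calc |⟪b i, f s - f t⟫| ≤ ‖b i‖ * ‖f s - f t‖ := abs_real_inner_le_norm _ _
      _ = dist (f s) (f t) := by rw [b.orthonormal.1 i, one_mul, dist_eq_norm]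
      _ ≤ _ := hf.dist_le_mul s t
  have hgood : ∀ᵐ t, ∀ i, DifferentiableAt ℝ (c i) t :=
    ae_all_iff.mpr fun i => (hcL i).ae_differentiableAt_real
  have hsum : ∀ t, (∀ i, DifferentiableAt ℝ (c i) t) → ∀ s : Finset w,
      ∑ i ∈ s, ‖deriv (c i) t‖ ^ (2 : ℝ≥0∞).toReal ≤ (L : ℝ) ^ (2 : ℝ≥0∞).toReal := by
    intro t ht s
    have e : (2 : ℝ≥0∞).toReal = ((2 : ℕ) : ℝ) := by norm_num
    rw [e]
    simp only [Real.rpow_natCast]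
    have hlim : Tendsto (fun h : ℝ => ∑ i ∈ s, ‖h⁻¹ • (c i (t + h) - c i t)‖ ^ 2) (𝓝[≠] 0)
        (𝓝 (∑ i ∈ s, ‖deriv (c i) t‖ ^ 2)) :=
      tendsto_finsetSum _ fun i _ => ((ht i).hasDerivAt.tendsto_slope_zero.norm.pow 2)
    refine le_of_tendsto hlim (eventually_nhdsWithin_of_forall fun h hh => ?_)
    have h1 := b.orthonormal.sum_inner_products_le (h⁻¹ • (f (t + h) - f t)) (s := s)
    have h2 : ‖h⁻¹ • (f (t + h) - f t)‖ ≤ L := by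
      rw [norm_smul, norm_inv, ← dist_eq_norm]
      have h3 := hf.dist_le_mul (t + h) t
      have h4 : dist (t + h) t = ‖h‖ := by simp
      rw [h4] at h3
      have h5 : 0 < ‖h‖ := norm_pos_iff.mpr hh
      rw [inv_mul_le_iff₀ h5]
      linarith
    calc ∑ i ∈ s, ‖h⁻¹ • (c i (t + h) - c i t)‖ ^ 2
        = ∑ i ∈ s, ‖⟪b i, h⁻¹ • (f (t + h) - f t)⟫‖ ^ 2 := by
          simp only [hc, inner_smul_right, inner_sub_right, smul_eq_mul]
      _ ≤ _ := h1
      _ ≤ _ := by gcongr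
  have hmem : ∀ t, (∀ i, DifferentiableAt ℝ (c i) t) → Memℓp (fun i => deriv (c i) t) 2 :=
    fun t ht => memℓp_gen' (hsum t ht)
  classical
  set V : ℝ → H := fun t =>
    if h : Memℓp (fun i => deriv (c i) t) 2 then b.repr.symm ⟨_, h⟩ else 0 with hV
  have hVr : ∀ t, (∀ i, DifferentiableAt ℝ (c i) t) → ∀ i, ⟪b i, V t⟫ = deriv (c i) t := by
    intro t ht i
    rw [← b.repr_apply_apply, hV]
    simp [hmem t ht]
  have hVb : ∀ᵐ t, ‖V t‖ ≤ L := by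
    filter_upwards [hgood] with t ht
    simp only [hV, hmem t ht, dif_pos, LinearIsometryEquiv.norm_map]
    exact lp.norm_le_of_forall_sum_le (by norm_num) L.2 (hsum t ht)
  have hVm : AEStronglyMeasurable V volume := by
    refine aestronglyMeasurable_of_tendsto_ae (atTop : Filter (Finset w))
      (f := fun s t => ∑ i ∈ s, deriv (c i) t • b i) (fun s => ?_) ?_
    · refine Finset.aestronglyMeasurable_fun_sum _ fun i _ => ?_
      exact ((measurable_deriv (c i)).aestronglyMeasurable).smul_const _
    · filter_upwards [hgood] with t ht
      have := b.hasSum_repr (V t)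
      simpa only [b.repr_apply_apply, hVr t ht, HasSum, SummationFilter.unconditional_filter]
        using this
  have hVi : LocallyIntegrable V volume := by
    intro x
    refine ⟨Metric.ball x 1, Metric.ball_mem_nhds x one_pos, ?_⟩
    exact Measure.integrableOn_of_bounded (M := L) measure_ball_lt_top.ne hVm
      (ae_restrict_of_ae hVb)
  have hFTC : ∀ t, ∫ s in (0 : ℝ)..t, V s = f t - f 0 := by
    intro t
    apply b.repr.injective
    ext i
    rw [b.repr_apply_apply, b.repr_apply_apply]
    have hi : IntervalIntegrable V volume 0 t :=
      (hVi.integrableOn_isCompact isCompact_uIcc).intervalIntegrable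
    have h1 : ⟪b i, ∫ s in (0 : ℝ)..t, V s⟫ = ∫ s in (0 : ℝ)..t, ⟪b i, V s⟫ :=
      ((innerSL ℝ (b i)).intervalIntegral_comp_comm hi).symm
    rw [h1, inner_sub_right]
    have h2 : ∫ s in (0 : ℝ)..t, ⟪b i, V s⟫ = ∫ s in (0 : ℝ)..t, deriv (c i) s := by
      refine intervalIntegral.integral_congr_ae ?_
      filter_upwards [hgood] with s hs _ using hVr s hs i
    rw [h2]
    exact ((hcL i).lipschitzOnWith.absolutelyContinuousOnInterval).integral_deriv_eq_sub
  filter_upwards [_root_.LocallyIntegrable.ae_hasDerivAt_integral hVi] with t ht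
  have h := (ht 0).const_add (f 0)
  simp only [hFTC, add_sub_cancel] at h
  exact h.differentiableAt

/-- Localized version of a.e. differentiability on the half line. -/
theorem ae_differentiableAt_of_lipschitzOnWith_Icc {H : Type*} [NormedAddCommGroup H]
    [InnerProductSpace ℝ H] [CompleteSpace H] [SecondCountableTopology H] {f : ℝ → H}
    (hf : ∀ T : ℝ, ∃ L : ℝ≥0, LipschitzOnWith L f (Icc 0 T)) :
    ∀ᵐ t ∂(volume.restrict (Ioi (0 : ℝ))), DifferentiableAt ℝ f t := by
  rw [ae_restrict_iff' measurableSet_Ioi]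
  have key : ∀ N : ℕ, ∀ᵐ t, t ∈ Ioo (0 : ℝ) N → DifferentiableAt ℝ f t := by
    intro N
    obtain ⟨L, hL⟩ := hf N
    have hp : LipschitzWith L (f ∘ fun t => ((projIcc (0 : ℝ) N N.cast_nonneg t : Icc _ _) : ℝ)) := by
      have h1 : LipschitzWith 1 fun t : ℝ => ((projIcc (0 : ℝ) N N.cast_nonneg t : Icc _ _) : ℝ) :=
        LipschitzWith.subtype_val _ |>.comp (LipschitzWith.projIcc _) |>.weaken (by simp)
      have h2 := hL.comp (h1.lipschitzOnWith (s := univ)) (fun t _ => (projIcc (0 : ℝ) N _ t).2)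
      rw [mul_one] at h2
      exact lipschitzOnWith_univ.mp h2
    filter_upwards [hp.ae_differentiableAt_of_hilbert] with t ht htN
    refine ht.congr_of_eventuallyEq ?_
    filter_upwards [Ioo_mem_nhds htN.1 htN.2] with s hs
    simp [projIcc_of_mem _ (Ioo_subset_Icc_self hs)]
  filter_upwards [ae_all_iff.mpr key] with t ht ht0
  obtain ⟨N, hN⟩ := exists_nat_gt t
  exact ht N ⟨ht0, hN⟩

/-- Gronwall's inequality for Lipschitz functions whose derivative satisfies a linear
differential inequality almost everywhere. -/
theorem gronwall_of_ae_deriv_le {g : ℝ → ℝ} {T A B : ℝ} (hA : 0 ≤ A) (hB : 0 ≤ B)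
    (hg0 : 0 ≤ g 0) {L : ℝ≥0}
    (hg : LipschitzOnWith L g (Icc 0 T))
    (hd : ∀ᵐ t ∂(volume.restrict (Ioo 0 T)), ∀ g', HasDerivAt g g' t → g' ≤ A * g t + B) :
    ∀ t ∈ Icc 0 T, g t ≤ (g 0 + B * T) * Real.exp (A * T) := by
  intro t ht
  have hgt : LipschitzOnWith L g (uIcc 0 t) := by
    rw [uIcc_of_le ht.1]; exact hg.mono (Icc_subset_Icc_right ht.2)
  have hac := hgt.absolutelyContinuousOnInterval
  have hE : AbsolutelyContinuousOnInterval (fun s => Real.exp (-A * s)) 0 t := by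
    have h1 : ContDiffOn ℝ 1 (fun s => Real.exp (-A * s)) (uIcc 0 t) := by fun_prop
    obtain ⟨K, hK⟩ := h1.exists_lipschitzOnWith (by norm_num) (convex_uIcc 0 t) isCompact_uIcc
    exact hK.absolutelyContinuousOnInterval
  have hprod := hE.fun_mul hac
  have hint := hprod.integral_deriv_eq_sub
  have hle : ∫ s in (0 : ℝ)..t, deriv (fun s => Real.exp (-A * s) * g s) s ≤
      ∫ _ in (0 : ℝ)..t, B := by
    refine intervalIntegral.integral_mono_ae_restrict ht.1 hprod.intervalIntegrable_deriv
      intervalIntegrable_const ?_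
    rw [Filter.EventuallyLE, Measure.restrict_congr_set Ioo_ae_eq_Icc.symm,
      ae_restrict_iff' measurableSet_Ioo]
    rw [ae_restrict_iff' measurableSet_Ioo] at hd
    have hdiff := hac.ae_differentiableAt
    filter_upwards [hd, hdiff] with s hs hs' hst
    have hs1 := hs' (by rw [uIcc_of_le ht.1]; exact Ioo_subset_Icc_self hst)
    have hs2 := hs ⟨hst.1, hst.2.trans_le ht.2⟩ _ hs1.hasDerivAt
    have hexp : HasDerivAt (fun s => Real.exp (-A * s)) (Real.exp (-A * s) * (-A * 1)) s :=
      ((hasDerivAt_id s).const_mul (-A)).exp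
    rw [(hexp.fun_mul hs1.hasDerivAt).deriv]
    have hpos := Real.exp_pos (-A * s)
    have hle1 : Real.exp (-A * s) ≤ 1 := Real.exp_le_one_iff.mpr (by nlinarith [hst.1])
    nlinarith [mul_le_mul_of_nonneg_left hs2 hpos.le, mul_le_mul_of_nonneg_right hle1 hB]
  rw [hint, intervalIntegral.integral_const] at hle
  simp only [mul_zero, Real.exp_zero, one_mul, smul_eq_mul, sub_zero] at hle
  have hexp2 : Real.exp (A * t) * Real.exp (-A * t) = 1 := by
    rw [← Real.exp_add]; simp
  have h3 : g t ≤ Real.exp (A * t) * (g 0 + B * t) := by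
    have := mul_le_mul_of_nonneg_left hle (Real.exp_pos (A * t)).le
    rw [mul_sub, ← mul_assoc, hexp2] at this
    linarith
  have h4 : Real.exp (A * t) ≤ Real.exp (A * T) := Real.exp_le_exp.mpr (by nlinarith [ht.2])
  have h5 : B * t * Real.exp (A * t) ≤ B * T * Real.exp (A * T) := by
    have : 0 ≤ B * t := mul_nonneg hB ht.1
    have h6 : B * t ≤ B * T := mul_le_mul_of_nonneg_left ht.2 hB
    exact mul_le_mul h6 h4 (Real.exp_pos _).le (this.trans h6)
  have h6 := mul_le_mul_of_nonneg_left h4 hg0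
  nlinarith

/-- The derivative of a Lipschitz convex function along a curve is bounded by a unit increment. -/
theorem deriv_comp_le_of_convexOn {H : Type*} [NormedAddCommGroup H] [NormedSpace ℝ H]
    {Φ : H → ℝ} {L : ℝ≥0} (hL : LipschitzWith L Φ) (hΦ : ConvexOn ℝ univ Φ) {x : ℝ → H} {v : H}
    {t d : ℝ} (hx : HasDerivAt x v t) (hd : HasDerivAt (fun s => Φ (x s)) d t) :
    d ≤ Φ (x t + v) - Φ (x t) := by
  set y : ℝ → H := fun s => x t + (s - t) • v with hy
  have hyt : y t = x t := by simp [hy]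
  have hdiff : HasDerivAt (fun s => Φ (y s) - Φ (x s)) 0 t := by
    rw [hasDerivAt_iff_isLittleO] at hx ⊢
    refine Asymptotics.IsBigO.trans_isLittleO (Asymptotics.IsBigO.of_bound L ?_) hx
    refine Eventually.of_forall fun s => ?_
    rw [hyt]
    have := hL.dist_le_mul (y s) (x s)
    rw [Real.dist_eq, dist_eq_norm] at this
    simp only [sub_self, sub_zero, smul_zero, Real.norm_eq_abs]
    refine this.trans (le_of_eq ?_)
    rw [← norm_neg]
    congr 2
    simp only [hy]; abel
  have h1 : HasDerivAt (fun s => Φ (y s)) d t := by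
    have := hdiff.fun_add hd
    simpa using this
  have hconv : ConvexOn ℝ univ (fun s => Φ (y s)) := by
    refine ⟨convex_univ, fun a _ b _ p q hp hq hpq => ?_⟩
    have h2 : y (p • a + q • b) = p • y a + q • y b := by
      simp only [hy, smul_add, smul_smul, smul_eq_mul]
      have h3 : x t = (p + q) • x t := by rw [hpq, one_smul]
      have h4 : p * a + q * b - t = p * (a - t) + q * (b - t) := by
        linear_combination (-t) * (hpq.symm) 
      rw [h4, add_smul]
      nth_rw 1 [h3]
      rw [add_smul]; abel
    simp only [h2]
    exact hΦ.2 trivial trivial hp hq hpq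
  have h5 := hconv.le_slope_of_hasDerivAt (mem_univ t) (mem_univ (t + 1)) (by linarith) h1
  simpa [slope_def_field, hy] using h5

instance isProbabilityMeasure_mu : IsProbabilityMeasure mu :=
  ⟨by simp [mu, Omg]⟩

theorem ae_mem_Omg : ∀ᵐ m ∂mu, m ∈ Omg := ae_restrict_mem measurableSet_Ioo

theorem exists_mem_Ioo_of_ae {p : ℝ → Prop} (hp : ∀ᵐ m ∂mu, p m) {a b : ℝ} (ha : 0 ≤ a)
    (hb : b ≤ 1) (hab : a < b) : ∃ m ∈ Ioo a b, p m := by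
  have h : ∀ᵐ m ∂(volume.restrict (Ioo a b)), p m :=
    ae_restrict_of_ae_restrict_of_subset (Ioo_subset_Ioo ha hb) hp
  have hne : (ae (volume.restrict (Ioo a b))).NeBot := by
    rw [ae_restrict_neBot]
    simp [hab]
  obtain ⟨m, hm, hm'⟩ := ((ae_restrict_mem measurableSet_Ioo).and h).exists
  exact ⟨m, hm, hm'⟩

/-- A function in `L²` which is nondecreasing on a set of full measure lies in the cone. -/
theorem mem_Kcone_of_ae {X : L2} {p : ℝ → Prop} (hp : ∀ᵐ m ∂mu, p m)
    (hX : ∀ a ∈ Omg, ∀ b ∈ Omg, p a → p b → a ≤ b → X a ≤ X b) : X ∈ Kcone := by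
  set S : ℝ → Set ℝ := fun m => {a | a ∈ Omg ∧ p a ∧ a ≤ m}
  have hne : ∀ m ∈ Omg, (X '' S m).Nonempty := by
    intro m hm
    obtain ⟨a, ha, hpa⟩ := exists_mem_Ioo_of_ae hp le_rfl hm.2.le hm.1
    exact ⟨_, a, ⟨⟨ha.1, ha.2.trans hm.2⟩, hpa, ha.2.le⟩, rfl⟩
  have hbdd : ∀ m ∈ Omg, BddAbove (X '' S m) := by
    intro m hm
    obtain ⟨b, hb, hpb⟩ := exists_mem_Ioo_of_ae hp hm.1.le le_rfl hm.2
    refine ⟨X b, ?_⟩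
    rintro _ ⟨a, ⟨ha, hpa, ham⟩, rfl⟩
    exact hX a ha b ⟨hm.1.trans hb.1, hb.2⟩ hpa hpb (ham.trans hb.1.le)
  refine ⟨fun m => sSup (X '' S m), fun m hm m' hm' hmm => ?_, ?_⟩
  · exact csSup_le_csSup (hbdd m' hm') (hne m hm)
      (image_mono fun a ha => ⟨ha.1, ha.2.1, ha.2.2.trans hmm⟩)
  · filter_upwards [hp, ae_mem_Omg] with m hpm hm
    refine le_antisymm (le_csSup (hbdd m hm) ⟨m, ⟨hm, hpm, le_rfl⟩, rfl⟩) ?_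
    refine csSup_le (hne m hm) ?_
    rintro _ ⟨a, ⟨ha, hpa, ham⟩, rfl⟩
    exact hX a ha m hm hpa hpm ham

theorem mem_Kcone_of_comp {X U Z : L2} (hX : X ∈ Kcone) (hU : U ∈ Kcone) {G : ℝ → ℝ → ℝ}
    (hG : ∀ a b c d, a ≤ b → c ≤ d → G a c ≤ G b d)
    (hZ : ∀ᵐ m ∂mu, Z m = G (X m) (U m)) : Z ∈ Kcone := by
  obtain ⟨g, hg, hXg⟩ := hX
  obtain ⟨u, hu, hUu⟩ := hU
  refine ⟨fun m => G (g m) (u m), fun a ha b hb hab => hG _ _ _ _ (hg ha hb hab) (hu ha hb hab), ?_⟩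
  filter_upwards [hXg, hUu, hZ] with m h1 h2 h3
  rw [h3, h1, h2]

theorem const_mem_Kcone (c : ℝ) : Lp.const 2 mu c ∈ Kcone :=
  ⟨fun _ => c, fun _ _ _ _ _ => le_rfl, Lp.coeFn_const 2 mu c⟩

theorem zero_mem_Kcone : (0 : L2) ∈ Kcone := by
  simpa using const_mem_Kcone 0

theorem convex_Kcone : Convex ℝ Kcone := by
  intro X hX U hU a b ha hb _
  refine mem_Kcone_of_comp hX hU (G := fun x u => a * x + b * u)
    (fun x x' u u' h h' => by gcongr) ?_
  filter_upwards [Lp.coeFn_add (a • X) (b • U), Lp.coeFn_smul a X, Lp.coeFn_smul b U]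
    with m h1 h2 h3
  rw [h1]
  simp [h2, h3]

theorem add_mem_Kcone {X U : L2} (hX : X ∈ Kcone) (hU : U ∈ Kcone) : X + U ∈ Kcone := by
  refine mem_Kcone_of_comp hX hU (G := fun x u => x + u) (fun x x' u u' h h' => by gcongr) ?_
  filter_upwards [Lp.coeFn_add X U] with m h1
  rw [h1]; rfl

theorem isClosed_Kcone : IsClosed Kcone := by
  refine isClosed_of_closure_subset fun X hX => ?_
  obtain ⟨x, hx, hlim⟩ := mem_closure_iff_seq_limit.mp hX
  obtain ⟨ns, -, hns⟩ := (tendstoInMeasure_of_tendsto_Lp hlim).exists_seq_tendsto_ae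
  choose g hg hxg using hx
  refine mem_Kcone_of_ae (p := fun m => (∀ n, x n m = g n m) ∧
    Tendsto (fun i => x (ns i) m) atTop (𝓝 (X m))) ?_ ?_
  · filter_upwards [ae_all_iff.mpr hxg, hns] with m h1 h2 using ⟨h1, h2⟩
  · rintro a ha b hb ⟨ha1, ha2⟩ ⟨hb1, hb2⟩ hab
    refine le_of_tendsto_of_tendsto' ha2 hb2 fun i => ?_
    rw [ha1, hb1]
    exact hg _ ha hb hab

theorem inner_const_of_mem_normalCone {X W : L2} (hX : X ∈ Kcone) (hW : W ∈ normalCone X) (c : ℝ) :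
    ⟪W, Lp.const 2 mu c⟫ = 0 := by
  have h1 := hW _ (add_mem_Kcone hX (const_mem_Kcone c))
  have h2 := hW _ (add_mem_Kcone hX (const_mem_Kcone (-c)))
  rw [add_sub_cancel_left] at h1 h2
  rw [map_neg, inner_neg_right] at h2
  linarith

/-- Normal vectors are nonnegatively correlated with monotone functions of a difference. -/
theorem inner_compLp_sub_nonneg {X U W : L2} (hX : X ∈ Kcone) (hU : U ∈ Kcone)
    (hW : W ∈ normalCone X) {φ : ℝ → ℝ} {L : ℝ≥0} (hφ : LipschitzWith L φ) (h0 : φ 0 = 0)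
    (hmono : Monotone φ) : 0 ≤ ⟪W, hφ.compLp h0 (X - U)⟫ := by
  set c : ℝ := ((L : ℝ) + 1)⁻¹ with hc
  have hL1 : (0 : ℝ) < (L : ℝ) + 1 := by positivity
  have hcpos : 0 < c := by positivity
  have hmem : X - c • hφ.compLp h0 (X - U) ∈ Kcone := by
    refine mem_Kcone_of_comp hX hU (G := fun x u => x - c * φ (x - u)) ?_ ?_
    · intro x x' u u' hx hu
      have h1 : φ (x - u') ≤ φ (x - u) := hmono (by linarith)
      have h2 := hφ.dist_le_mul (x' - u') (x - u')
      rw [Real.dist_eq, Real.dist_eq, sub_sub_sub_cancel_right, abs_of_nonneg (sub_nonneg.mpr hx)]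
        at h2
      have h3 := (le_abs_self _).trans h2
      have h4 : c * (L * (x' - x)) ≤ x' - x := by
        rw [hc, inv_mul_le_iff₀ hL1]
        nlinarith
      have h5 := mul_le_mul_of_nonneg_left h3 hcpos.le
      have h6 := mul_le_mul_of_nonneg_left h1 hcpos.le
      linarith
    · filter_upwards [Lp.coeFn_sub X (c • hφ.compLp h0 (X - U)),
        Lp.coeFn_smul c (hφ.compLp h0 (X - U)), hφ.coeFn_compLp h0 (X - U), Lp.coeFn_sub X U]
        with m h1 h2 h3 h4
      rw [h1, Pi.sub_apply, h2, Pi.smul_apply, h3, Function.comp_apply, h4]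
      rfl
  have h := hW _ hmem
  rw [sub_sub_cancel_left, inner_neg_right, inner_smul_right] at h
  nlinarith

theorem inner_compLp_deriv_nonneg {X : ℝ → L2} {V W : L2} {t : ℝ} (ht : 0 < t)
    (hX : ∀ s, 0 ≤ s → X s ∈ Kcone) (hV : HasDerivAt X V t) (hW : W ∈ normalCone (X t))
    {φ : ℝ → ℝ} {L : ℝ≥0} (hφ : LipschitzWith L φ) (h0 : φ 0 = 0) (hmono : Monotone φ) :
    0 ≤ ⟪W, hφ.compLp h0 V⟫ := by
  have hlim := hV.tendsto_slope_zero_left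
  have hlim2 : Tendsto (fun h : ℝ => ⟪W, hφ.compLp h0 (h⁻¹ • (X (t + h) - X t))⟫) (𝓝[<] 0)
      (𝓝 ⟪W, hφ.compLp h0 V⟫) :=
    tendsto_const_nhds.inner (((hφ.continuous_compLp h0).tendsto V).comp hlim)
  refine ge_of_tendsto hlim2 ?_
  have hev : ∀ᶠ h : ℝ in 𝓝[<] 0, h ∈ Ioo (-t) 0 := Ioo_mem_nhdsLT (by linarith)
  filter_upwards [hev] with h hh
  set k : ℝ≥0 := ⟨-h⁻¹, by simpa using hh.2.le⟩ with hk
  have hkr : (k : ℝ) = -h⁻¹ := rfl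
  have hmul : LipschitzWith k fun r : ℝ => -h⁻¹ * r := by
    refine LipschitzWith.of_dist_le_mul fun a b => ?_
    rw [Real.dist_eq, ← mul_sub, abs_mul, Real.dist_eq, hkr, abs_of_nonneg]
    exact k.2
  have hφh := hφ.comp hmul
  have h0h : (φ ∘ fun r : ℝ => -h⁻¹ * r) 0 = 0 := by simp [h0]
  have hmonoh : Monotone (φ ∘ fun r : ℝ => -h⁻¹ * r) :=
    hmono.comp fun a b hab => mul_le_mul_of_nonneg_left hab k.2
  have key := inner_compLp_sub_nonneg (hX t ht.le) (hX (t + h) (by linarith [hh.1])) hW hφh h0h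
    hmonoh
  have heq : hφh.compLp h0h (X t - X (t + h)) = hφ.compLp h0 (h⁻¹ • (X (t + h) - X t)) := by
    have hsm : h⁻¹ • (X (t + h) - X t) = (-h⁻¹) • (X t - X (t + h)) := by
      rw [neg_smul, ← smul_neg, neg_sub]
    rw [hsm]
    refine Lp.ext ?_
    filter_upwards [hφh.coeFn_compLp h0h (X t - X (t + h)),
      hφ.coeFn_compLp h0 ((-h⁻¹) • (X t - X (t + h))),
      Lp.coeFn_smul (-h⁻¹) (X t - X (t + h))] with m h1 h2 h3
    rw [h1, h2, Function.comp_apply, Function.comp_apply, Function.comp_apply, h3]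
    rfl
  rwa [heq] at key

/-- The velocity of a curve in the cone is dominated in norm by any `Y` with `Y - V` normal. -/
theorem norm_deriv_le {X : ℝ → L2} {V Y : L2} {t : ℝ} (ht : 0 < t)
    (hX : ∀ s, 0 ≤ s → X s ∈ Kcone) (hV : HasDerivAt X V t) (hW : Y - V ∈ normalCone (X t)) :
    ‖V‖ ≤ ‖Y‖ := by
  have h := inner_compLp_deriv_nonneg ht hX hV hW LipschitzWith.id rfl monotone_id
  have hid : (LipschitzWith.id (α := ℝ)).compLp rfl V = V := by
    refine Lp.ext ?_
    filter_upwards [(LipschitzWith.id (α := ℝ)).coeFn_compLp rfl V] with m h1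
    rw [h1]; rfl
  rw [hid, inner_sub_left, real_inner_self_eq_norm_sq] at h
  have h2 := real_inner_le_norm Y V
  by_contra! hlt
  nlinarith [norm_nonneg V, norm_nonneg Y]

theorem UnifCont.continuousOn {F : L2 → L2} (hF : UnifCont F) : ContinuousOn F Kcone := by
  obtain ⟨-, ω, hωc, -, -, hω0, -, hω⟩ := hF
  intro X hX
  rw [ContinuousWithinAt, tendsto_iff_norm_sub_tendsto_zero]
  have h1 : Tendsto (fun Z : L2 => ‖Z - X‖) (𝓝[Kcone] X) (𝓝[Ici 0] 0) := by
    refine tendsto_nhdsWithin_iff.mpr ⟨?_, Eventually.of_forall fun Z => norm_nonneg _⟩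
    exact (tendsto_iff_norm_sub_tendsto_zero.mp tendsto_id).mono_left nhdsWithin_le_nhds
  have h2 := (hωc 0 self_mem_Ici).tendsto.comp h1
  rw [hω0] at h2
  refine squeeze_zero' (Eventually.of_forall fun _ => norm_nonneg _) ?_ h2
  filter_upwards [self_mem_nhdsWithin] with Z hZ using hω Z hZ X hX

theorem LagSol.continuousOn {F : L2 → L2} {Xbar Vbar : L2} {X : ℝ → L2}
    (h : LagSol F Xbar Vbar X) : ContinuousOn X (Ici 0) := by
  intro t ht
  obtain ⟨L, hL⟩ := h.2.2.1 (t + 1)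
  refine (hL.continuousOn t ⟨ht, by linarith⟩).mono_of_mem_nhdsWithin ?_
  have := inter_mem_nhdsWithin (Ici (0 : ℝ)) (Iic_mem_nhds (lt_add_one t))
  simpa [Ici_inter_Iic] using this

/-- The curve `t ↦ F (X t)`, extended by its initial value to negative times. -/
theorem LagSol.continuous_force {F : L2 → L2} {Xbar Vbar : L2} {X : ℝ → L2}
    (h : LagSol F Xbar Vbar X) (hF : ContinuousOn F Kcone) :
    Continuous fun t => F (X (max 0 t)) := by
  refine hF.comp_continuous ?_ fun t => h.1 _ (le_max_left 0 t)
  exact h.continuousOn.comp_continuous (by fun_prop) fun t => le_max_left 0 t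

theorem intervalIntegral_force_eq {F : L2 → L2} (X : ℝ → L2) {t : ℝ} (ht : 0 ≤ t) :
    ∫ s in (0 : ℝ)..t, F (X (max 0 s)) = ∫ s in Ioc (0 : ℝ) t, F (X s) := by
  rw [intervalIntegral.integral_of_le ht]
  refine setIntegral_congr_fun measurableSet_Ioc fun s hs => ?_
  simp only [max_eq_right hs.1.le]

/-- A priori bound for a convex functional along Lagrangian solutions. -/
theorem LagSol.apriori_bound {F : L2 → L2} (hF : ContinuousOn F Kcone) {Φ : L2 → ℝ} {R : ℝ≥0}
    (hΦL : LipschitzWith R Φ) (hΦ : ConvexOn ℝ univ Φ) (hΦ0 : ∀ Z, 0 ≤ Φ Z) {k a b : ℝ}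
    (hk0 : 0 ≤ k) (ha : 0 ≤ a) (hb : 0 ≤ b) (hk : ∀ x v, Φ (x + v) - Φ x ≤ k * (Φ x + Φ v))
    (hFb : ∀ Z ∈ Kcone, Φ (F Z) ≤ a + b * Φ Z)
    (hord : ∀ (X : ℝ → L2) (V Y : L2) (t : ℝ), 0 < t → (∀ s, 0 ≤ s → X s ∈ Kcone) →
      HasDerivAt X V t → Y - V ∈ normalCone (X t) → Φ V ≤ Φ Y)
    {Xbar Vbar : L2} {X : ℝ → L2} (h : LagSol F Xbar Vbar X) (T : ℝ) :
    ∀ᵐ t ∂(volume.restrict (Icc (0 : ℝ) T)), ∀ V : L2, HasDerivAt X V t →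
      Φ (X t) + Φ V ≤ (Φ Xbar + Φ Vbar + k * a * T) * Real.exp (k * (2 + b) * T) := by
  have hG := h.continuous_force hF
  set Y : ℝ → L2 := fun t => Vbar + ∫ s in (0 : ℝ)..t, F (X (max 0 s)) with hY
  have hYd : ∀ t, HasDerivAt Y (F (X (max 0 t))) t := fun t =>
    (intervalIntegral.integral_hasDerivAt_right (hG.intervalIntegrable _ _)
      hG.aestronglyMeasurable.stronglyMeasurableAtFilter hG.continuousAt).const_add Vbar
  have hYL : ∀ T : ℝ, ∃ L : ℝ≥0, LipschitzOnWith L Y (Icc 0 T) := by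
    intro T
    obtain ⟨C, hC⟩ := isCompact_Icc.exists_bound_of_continuousOn (s := Icc (0 : ℝ) T)
      hG.continuousOn
    refine ⟨C.toNNReal, (convex_Icc 0 T).lipschitzOnWith_of_nnnorm_hasDerivWithin_le
      (fun t _ => (hYd t).hasDerivWithinAt) fun t ht => ?_⟩
    rw [← NNReal.coe_le_coe, coe_nnnorm]
    exact (hC t ht).trans (Real.le_coe_toNNReal C)
  have hΦX : ∀ T : ℝ, ∃ L : ℝ≥0, LipschitzOnWith L (fun t => Φ (X t)) (Icc 0 T) := fun T => by
    obtain ⟨L, hL⟩ := h.2.2.1 T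
    exact ⟨_, hΦL.comp_lipschitzOnWith hL⟩
  have hΦY : ∀ T : ℝ, ∃ L : ℝ≥0, LipschitzOnWith L (fun t => Φ (Y t)) (Icc 0 T) := fun T => by
    obtain ⟨L, hL⟩ := hYL T
    exact ⟨_, hΦL.comp_lipschitzOnWith hL⟩
  have hX0 : X 0 = Xbar := h.2.1
  have hY0 : Y 0 = Vbar := by simp [hY]
  obtain ⟨L1, hL1⟩ := hΦX T
  obtain ⟨L2, hL2⟩ := hΦY T
  have hgood : ∀ᵐ t ∂(volume.restrict (Ioi (0 : ℝ))),
      ∃ V, HasDerivAt X V t ∧ Φ V ≤ Φ (Y t) := by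
    filter_upwards [h.2.2.2, ae_restrict_mem measurableSet_Ioi] with t ht ht0
    obtain ⟨V, hV, hN⟩ := ht
    refine ⟨V, hV, hord X V (Y t) t ht0 h.1 hV ?_⟩
    simpa only [hY, intervalIntegral_force_eq X (le_of_lt ht0)] using hN
  have hgron := gronwall_of_ae_deriv_le (g := fun t => Φ (X t) + Φ (Y t)) (T := T)
    (A := k * (2 + b)) (B := k * a) (by positivity) (by positivity)
    (add_nonneg (hΦ0 _) (hΦ0 _)) (hL1.add hL2) (by
      have hsub : Ioo 0 T ⊆ Ioi (0 : ℝ) := fun t ht => ht.1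
      filter_upwards [ae_restrict_of_ae_restrict_of_subset hsub hgood,
        ae_restrict_of_ae_restrict_of_subset hsub (ae_differentiableAt_of_lipschitzOnWith_Icc hΦX),
        ae_restrict_of_ae_restrict_of_subset hsub (ae_differentiableAt_of_lipschitzOnWith_Icc hΦY),
        ae_restrict_mem measurableSet_Ioo] with t ht h1 h2 ht0 g' hg'
      obtain ⟨V, hV, hVY⟩ := ht
      have e1 := deriv_comp_le_of_convexOn hΦL hΦ hV h1.hasDerivAt
      have e2 := deriv_comp_le_of_convexOn hΦL hΦ (hYd t) h2.hasDerivAt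
      have e3 := hg'.unique (h1.hasDerivAt.fun_add h2.hasDerivAt)
      rw [max_eq_right ht0.1.le] at e2
      have e4 := hk (X t) V
      have e5 := hk (Y t) (F (X t))
      have e6 := mul_le_mul_of_nonneg_left (hFb _ (h.1 t ht0.1.le)) hk0
      have e7 := mul_le_mul_of_nonneg_left hVY hk0
      have e8 : 0 ≤ k * Φ (X t) := mul_nonneg hk0 (hΦ0 _)
      have e9 : 0 ≤ k * b * Φ (Y t) := mul_nonneg (mul_nonneg hk0 hb) (hΦ0 _)
      rw [e3]
      nlinarith)
  rw [hX0, hY0] at hgron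
  rw [Measure.restrict_congr_set Ioo_ae_eq_Icc.symm]
  filter_upwards [ae_restrict_of_ae_restrict_of_subset (fun t ht => ht.1) hgood,
    ae_restrict_mem measurableSet_Ioo] with t ht ht0 V hV
  obtain ⟨V', hV', hVY⟩ := ht
  rw [hV.unique hV']
  exact (add_le_add_right hVY _).trans (hgron t (Ioo_subset_Icc_self ht0))

/-- The `L²` a priori bound. -/
theorem LagSol.norm_bound {F : L2 → L2} (hF : UnifCont F) {T : ℝ} (hT : 0 ≤ T) :
    ∃ CT : ℝ, 0 ≤ CT ∧ ∀ Xbar Vbar : L2, ∀ X : ℝ → L2, LagSol F Xbar Vbar X →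
      ∀ᵐ t ∂(volume.restrict (Icc (0 : ℝ) T)), ∀ V : L2, HasDerivAt X V t →
        ‖X t‖ + ‖V‖ ≤ CT * (1 + ‖Xbar‖ + ‖Vbar‖) := by
  obtain ⟨C, hC, hFC⟩ := hF.1
  refine ⟨(1 + C * T) * Real.exp (1 * (2 + C) * T), by positivity, fun Xbar Vbar X h => ?_⟩
  have := h.apriori_bound hF.continuousOn (Φ := fun Z => ‖Z‖) lipschitzWith_one_norm
    (convexOn_norm convex_univ) (fun Z => norm_nonneg Z) (k := 1) (a := C) (b := C) zero_le_one hC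
    hC (fun x v => by linarith [norm_add_le x v, norm_nonneg x])
    (fun Z hZ => (hFC Z hZ).trans (le_of_eq (by ring)))
    (fun X V Y t ht hX hV hN => norm_deriv_le ht hX hV hN) T
  filter_upwards [this] with t ht V hV
  refine (ht V hV).trans ?_
  rw [mul_right_comm (1 + C * T)]
  refine mul_le_mul_of_nonneg_right ?_ (Real.exp_pos _).le
  have h1 : 0 ≤ C * T := by positivity
  nlinarith [mul_nonneg h1 (norm_nonneg Xbar), mul_nonneg h1 (norm_nonneg Vbar)]

theorem integral_abs_le_norm (f : L2) : ∫ m, |f m| ∂mu ≤ ‖f‖ := by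
  have h1 : ∫ m, |f m| ∂mu = (eLpNorm f 1 mu).toReal := by
    rw [eLpNorm_one_eq_lintegral_enorm,
      ← integral_norm_eq_lintegral_enorm (Lp.aestronglyMeasurable f)]
    rfl
  rw [h1, Lp.norm_def]
  exact ENNReal.toReal_mono (Lp.eLpNorm_ne_top f)
    (eLpNorm_le_eLpNorm_of_exponent_le one_le_two (Lp.aestronglyMeasurable f))

theorem integrable_coe (f : L2) : Integrable f mu := (Lp.memLp f).integrable one_le_two

/-- Lipschitz, even, convex functions vanishing at the origin, with a doubling property. -/
structure LipschitzDoubling (ψ : ℝ → ℝ) (q : ℝ) (R : ℝ≥0) : Prop where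
  nonneg : ∀ r, 0 ≤ ψ r
  even : ∀ r, ψ (-r) = ψ r
  convex : ConvexOn ℝ univ ψ
  lipschitz : LipschitzWith R ψ
  zero : ψ 0 = 0
  one_le : 1 ≤ q
  doubling : ∀ r l : ℝ, 1 ≤ l → ψ (l * r) ≤ l ^ q * ψ r

namespace LipschitzDoubling

variable {ψ : ℝ → ℝ} {q : ℝ} {R : ℝ≥0}

theorem mono_abs (h : LipschitzDoubling ψ q R) {x y : ℝ} (hxy : |x| ≤ y) : ψ x ≤ ψ y := by
  have h1 := h.convex.le_max_of_mem_Icc (x := -y) (y := y) trivial trivial (abs_le.mp hxy)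
  simpa [h.even] using h1

theorem add_le (h : LipschitzDoubling ψ q R) (x v : ℝ) : ψ (x + v) ≤ 2 ^ q * (ψ x + ψ v) := by
  have h1 := h.doubling ((1 / 2 : ℝ) • x + (1 / 2 : ℝ) • v) 2 one_le_two
  have h2 := h.convex.2 (mem_univ x) (mem_univ v) (by norm_num : (0 : ℝ) ≤ 1 / 2)
    (by norm_num : (0 : ℝ) ≤ 1 / 2) (by norm_num)
  have h3 : 2 * ((1 / 2 : ℝ) • x + (1 / 2 : ℝ) • v) = x + v := by simp only [smul_eq_mul]; ring
  rw [h3] at h1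
  refine h1.trans (mul_le_mul_of_nonneg_left (h2.trans ?_) (by positivity))
  simp only [smul_eq_mul]
  linarith [h.nonneg x, h.nonneg v]

theorem le_of_abs_le (h : LipschitzDoubling ψ q R) {C x a b : ℝ} (ha : 0 ≤ a)
    (hb : 0 ≤ b) (hx : |x| ≤ C * (1 + a + b)) :
    ψ x ≤ (max 1 (3 * C)) ^ q * (ψ 1 + ψ a + ψ b) / 3 := by
  set l := max 1 (3 * C) with hl
  have hl1 : 1 ≤ l := le_max_left _ _
  have hl3 : 3 * C ≤ l := le_max_right _ _
  have h1 : |x| ≤ l * ((1 / 3 : ℝ) • 1 + (2 / 3 : ℝ) • ((1 / 2 : ℝ) • a + (1 / 2 : ℝ) • b)) := by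
    simp only [smul_eq_mul]
    have := mul_le_mul_of_nonneg_right hl3 (by positivity : 0 ≤ 1 + a + b)
    nlinarith
  refine (h.mono_abs h1).trans ((h.doubling _ l hl1).trans ?_)
  rw [mul_div_assoc]
  refine mul_le_mul_of_nonneg_left ?_ (by positivity)
  have h2 := h.convex.2 (mem_univ (1 : ℝ)) (mem_univ ((1 / 2 : ℝ) • a + (1 / 2 : ℝ) • b))
    (by norm_num : (0 : ℝ) ≤ 1 / 3) (by norm_num : (0 : ℝ) ≤ 2 / 3) (by norm_num)
  have h3 := h.convex.2 (mem_univ a) (mem_univ b) (by norm_num : (0 : ℝ) ≤ 1 / 2)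
    (by norm_num : (0 : ℝ) ≤ 1 / 2) (by norm_num)
  simp only [smul_eq_mul] at h2 h3 ⊢
  linarith

theorem integrable (h : LipschitzDoubling ψ q R) (Z : L2) : Integrable (fun m => ψ (Z m)) mu :=
  (integrable_coe (h.lipschitz.compLp h.zero Z)).congr (h.lipschitz.coeFn_compLp h.zero Z)

theorem lipschitzWith_integral (h : LipschitzDoubling ψ q R) :
    LipschitzWith R fun Z : L2 => ∫ m, ψ (Z m) ∂mu := by
  refine LipschitzWith.of_dist_le_mul fun Z U => ?_
  rw [Real.dist_eq, ← integral_sub (h.integrable Z) (h.integrable U), dist_eq_norm]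
  refine (abs_integral_le_integral_abs).trans ?_
  refine le_trans ?_ (h.lipschitz.norm_compLp_sub_le h.zero Z U)
  refine le_trans (le_of_eq (integral_congr_ae ?_)) (integral_abs_le_norm _)
  filter_upwards [Lp.coeFn_sub (h.lipschitz.compLp h.zero Z) (h.lipschitz.compLp h.zero U),
    h.lipschitz.coeFn_compLp h.zero Z, h.lipschitz.coeFn_compLp h.zero U] with m h1 h2 h3
  rw [h1, Pi.sub_apply, h2, h3]; rfl

theorem convexOn_integral (h : LipschitzDoubling ψ q R) :
    ConvexOn ℝ univ fun Z : L2 => ∫ m, ψ (Z m) ∂mu := by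
  refine ⟨convex_univ, fun Z _ U _ a b ha hb hab => ?_⟩
  rw [smul_eq_mul, smul_eq_mul, ← integral_const_mul, ← integral_const_mul,
    ← integral_add ((h.integrable Z).const_mul a) ((h.integrable U).const_mul b)]
  refine integral_mono_ae (h.integrable _)
    (((h.integrable Z).const_mul a).add ((h.integrable U).const_mul b)) ?_
  filter_upwards [Lp.coeFn_add (a • Z) (b • U), Lp.coeFn_smul a Z, Lp.coeFn_smul b U]
    with m h1 h2 h3
  rw [h1, Pi.add_apply, h2, h3]
  exact h.convex.2 trivial trivial ha hb hab

theorem integral_add_le (h : LipschitzDoubling ψ q R) (Z U : L2) :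
    ∫ m, ψ ((Z + U : L2) m) ∂mu ≤ 2 ^ q * (∫ m, ψ (Z m) ∂mu + ∫ m, ψ (U m) ∂mu) := by
  rw [← integral_add (h.integrable Z) (h.integrable U), ← integral_const_mul]
  refine integral_mono_ae (h.integrable _)
    (((h.integrable Z).add (h.integrable U)).const_mul _) ?_
  filter_upwards [Lp.coeFn_add Z U] with m h1
  rw [h1]
  exact h.add_le _ _

theorem integral_force_le (h : LipschitzDoubling ψ q R) {F : L2 → L2} {Cp : ℝ}
    (hF : PtwLinBdd F Cp) {Z : L2} (hZ : Z ∈ Kcone) :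
    ∫ m, ψ (F Z m) ∂mu ≤ (max 1 (3 * Cp)) ^ q * ψ 1 +
      (max 1 (3 * Cp)) ^ q * ∫ m, ψ (Z m) ∂mu := by
  set D := (max 1 (3 * Cp)) ^ q with hD
  have hD0 : 0 ≤ D := Real.rpow_nonneg (le_trans zero_le_one (le_max_left _ _)) _
  set N := ∫ m, |Z m| ∂mu with hN
  have habs : ∀ r, ψ |r| = ψ r := fun r => by
    rcases abs_choice r with h1 | h1 <;> rw [h1]
    exact h.even r
  have hjensen : ψ N ≤ ∫ m, ψ (Z m) ∂mu := by
    have h1 := h.convex.map_integral_le (μ := mu) (f := fun m => |Z m|)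
      h.lipschitz.continuous.continuousOn isClosed_univ (Eventually.of_forall fun _ => trivial)
      (integrable_coe Z).abs (by simpa only [Function.comp_def, habs] using h.integrable Z)
    simpa only [habs] using h1
  have h1 : ∫ m, ψ (F Z m) ∂mu ≤ ∫ m, (D / 3 * (ψ 1 + ψ N) + D / 3 * ψ (Z m)) ∂mu := by
    refine integral_mono_ae (h.integrable _)
      ((integrable_const _).add ((h.integrable Z).const_mul _)) ?_
    filter_upwards [hF.2 Z hZ] with m hm
    have h2 := h.le_of_abs_le (abs_nonneg _)
      (integral_nonneg fun m => abs_nonneg (Z m)) hm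
    rw [habs, ← hD, ← hN] at h2
    linarith
  rw [integral_add (integrable_const _) ((h.integrable Z).const_mul _), integral_const,
    integral_const_mul] at h1
  simp only [probReal_univ, one_smul] at h1
  have h0 : 0 ≤ ∫ m, ψ (Z m) ∂mu := integral_nonneg fun m => h.nonneg _
  have h3 := mul_le_mul_of_nonneg_left hjensen hD0
  have h4 := mul_nonneg hD0 (h.nonneg 1)
  have h5 := mul_nonneg hD0 h0
  linarith

/-- Difference quotients of a Lipschitz convex function are approximate subgradients. -/
theorem slope_subgradient (h : LipschitzDoubling ψ q R) {δ : ℝ} (hδ : 0 < δ) (x y : ℝ) :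
    ψ x + (y - x) * ((ψ (x + δ) - ψ x) / δ) - 2 * R * δ ≤ ψ y := by
  have hR : (0 : ℝ) ≤ R := R.2
  have hlip : ∀ a b, |ψ a - ψ b| ≤ R * |a - b| := fun a b => h.lipschitz.dist_le_mul a b
  have hRδ : 0 ≤ R * δ := mul_nonneg hR hδ.le
  rcases lt_trichotomy y x with hy | rfl | hy
  · have := h.convex.secant_mono (a := x) (x := y) (y := x + δ) trivial trivial trivial hy.ne
      (by linarith) (by linarith)
    rw [add_sub_cancel_left, ← neg_div_neg_eq, div_le_iff₀ (by linarith)] at this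
    nlinarith
  · simp only [sub_self, zero_mul, add_zero]; nlinarith
  · by_cases hyδ : x + δ ≤ y
    · have := h.convex.secant_mono (a := x) (x := x + δ) (y := y) trivial trivial trivial
        (by linarith) hy.ne' hyδ
      rw [add_sub_cancel_left, le_div_iff₀ (by linarith)] at this
      nlinarith
    · have h1 : (ψ (x + δ) - ψ x) / δ ≤ R := by
        rw [div_le_iff₀ hδ]
        have := (le_abs_self _).trans (hlip (x + δ) x)
        rwa [add_sub_cancel_left, abs_of_pos hδ] at this
      have h2 := (neg_abs_le _).trans' (neg_le_neg (hlip y x))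
      rw [abs_of_pos (by linarith : 0 < y - x)] at h2
      have h3 : (y - x) * ((ψ (x + δ) - ψ x) / δ) ≤ (y - x) * R :=
        mul_le_mul_of_nonneg_left h1 (by linarith)
      have h4 : R * (y - x) ≤ R * δ := mul_le_mul_of_nonneg_left (by linarith) hR
      nlinarith

theorem slope_monotone (h : LipschitzDoubling ψ q R) {δ : ℝ} (hδ : 0 < δ) :
    Monotone fun x => (ψ (x + δ) - ψ x) / δ := by
  intro x x' hx
  rcases hx.eq_or_lt with rfl | hx
  · exact le_rfl
  have h1 := h.convex.secant_mono (a := x) (x := x + δ) (y := x' + δ) trivial trivial trivial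
    (by linarith) (by linarith) (by linarith)
  have h2 := h.convex.secant_mono (a := x' + δ) (x := x) (y := x') trivial trivial trivial
    (by linarith) (by linarith) hx.le
  rw [← neg_div_neg_eq, ← neg_div_neg_eq (ψ x' - _)] at h2
  simp only [neg_sub, add_sub_cancel_left] at h1 h2
  exact h1.trans h2

theorem slope_lipschitz (h : LipschitzDoubling ψ q R) {δ : ℝ} (hδ : 0 < δ) :
    LipschitzWith (2 * R / δ.toNNReal) fun x => (ψ (x + δ) - ψ x) / δ := by
  refine LipschitzWith.of_dist_le_mul fun x y => ?_
  have h1 := h.lipschitz.dist_le_mul (x + δ) (y + δ)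
  have h2 := h.lipschitz.dist_le_mul x y
  rw [dist_add_right] at h1
  rw [Real.dist_eq] at h1 h2 ⊢
  rw [← sub_div, abs_div, abs_of_pos hδ, div_le_iff₀ hδ]
  have h3 : ((2 * R / δ.toNNReal : ℝ≥0) : ℝ) * dist x y * δ = 2 * (R * dist x y) := by
    push_cast
    rw [Real.coe_toNNReal δ hδ.le]
    field_simp
  rw [h3]
  have h4 : ψ (x + δ) - ψ x - (ψ (y + δ) - ψ y) = (ψ (x + δ) - ψ (y + δ)) - (ψ x - ψ y) := by ring
  rw [h4]
  exact (abs_sub _ _).trans (by linarith)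

/-- The velocity of a curve in the cone is dominated by `Y` in the convex order. -/
theorem integral_deriv_le (h : LipschitzDoubling ψ q R) {X : ℝ → L2} {V Y : L2} {t : ℝ}
    (ht : 0 < t) (hX : ∀ s, 0 ≤ s → X s ∈ Kcone) (hV : HasDerivAt X V t)
    (hW : Y - V ∈ normalCone (X t)) : ∫ m, ψ (V m) ∂mu ≤ ∫ m, ψ (Y m) ∂mu := by
  have key : ∀ δ : ℝ, 0 < δ → ∫ m, ψ (V m) ∂mu ≤ ∫ m, ψ (Y m) ∂mu + 2 * R * δ := by
    intro δ hδ
    set c : ℝ := (ψ (0 + δ) - ψ 0) / δ with hc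
    have hφ : LipschitzWith (2 * R / δ.toNNReal) fun x => (ψ (x + δ) - ψ x) / δ - c := by
      have := (h.slope_lipschitz hδ).sub (LipschitzWith.const c)
      rwa [add_zero] at this
    have h0 : (fun x => (ψ (x + δ) - ψ x) / δ - c) 0 = 0 := sub_self _
    have hpos := inner_compLp_deriv_nonneg ht hX hV hW hφ h0
      fun a b hab => sub_le_sub_right (h.slope_monotone hδ hab) c
    have hconst := inner_const_of_mem_normalCone (hX t ht.le) hW c
    have hi1 := L2.integrable_inner (𝕜 := ℝ) (Y - V) (hφ.compLp h0 V)
    have hi2 := L2.integrable_inner (𝕜 := ℝ) (Y - V) (Lp.const 2 mu c)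
    have hi3 : Integrable (fun m => ⟪(Y - V) m, hφ.compLp h0 V m⟫ +
        ⟪(Y - V) m, Lp.const 2 mu c m⟫) mu := hi1.add hi2
    have hi4 : Integrable (fun m => ψ (V m) + (⟪(Y - V) m, hφ.compLp h0 V m⟫ +
        ⟪(Y - V) m, Lp.const 2 mu c m⟫)) mu := (h.integrable V).add hi3
    have hle : ∫ m, (ψ (V m) + (⟪(Y - V) m, hφ.compLp h0 V m⟫ + ⟪(Y - V) m, Lp.const 2 mu c m⟫)
        - 2 * R * δ) ∂mu ≤ ∫ m, ψ (Y m) ∂mu := by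
      refine integral_mono_ae (hi4.sub (integrable_const _)) (h.integrable Y) ?_
      filter_upwards [Lp.coeFn_sub Y V, hφ.coeFn_compLp h0 V, Lp.coeFn_const 2 mu c]
        with m h1 h2 h3
      rw [h1, h2, h3]
      have := h.slope_subgradient hδ (V m) (Y m)
      simp only [Pi.sub_apply, Function.comp_apply, Function.const_apply, RCLike.inner_apply,
        conj_trivial]
      linarith
    rw [integral_sub hi4 (integrable_const _), integral_add (h.integrable V) hi3,
      integral_add hi1 hi2, ← L2.inner_def, ← L2.inner_def, hconst, integral_const] at hle
    simp only [probReal_univ, one_smul] at hle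
    linarith
  refine le_of_forall_pos_le_add fun ε hε => ?_
  have hR : (0 : ℝ) < 2 * R + 1 := by positivity
  refine (key (ε / (2 * R + 1)) (by positivity)).trans ?_
  gcongr
  rw [mul_div_assoc', div_le_iff₀ hR]
  nlinarith

end LipschitzDoubling

/-- The Lipschitz regularization of `ψ` with Lipschitz constant `R`. -/
def lipschitzEnvelope (ψ : ℝ → ℝ) (R : ℝ≥0) (x : ℝ) : ℝ := ⨅ y, (ψ y + R * |x - y|)

section lipschitzEnvelope

variable {ψ : ℝ → ℝ} {q : ℝ} {R : ℝ≥0}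

theorem lipschitzEnvelope_le (h : ∀ r, 0 ≤ ψ r) (R : ℝ≥0) (x y : ℝ) :
    lipschitzEnvelope ψ R x ≤ ψ y + R * |x - y| :=
  ciInf_le ⟨0, by rintro _ ⟨y, rfl⟩; have := h y; positivity⟩ y

theorem le_lipschitzEnvelope {x c : ℝ} (h : ∀ y, c ≤ ψ y + R * |x - y|) :
    c ≤ lipschitzEnvelope ψ R x := le_ciInf h

theorem lipschitzEnvelope_le_self (h : ∀ r, 0 ≤ ψ r) (R : ℝ≥0) (x : ℝ) :
    lipschitzEnvelope ψ R x ≤ ψ x := by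
  simpa using lipschitzEnvelope_le h R x x

theorem AdmissibleDoubling.lipschitzDoubling_envelope (h : AdmissibleDoubling ψ q) (R : ℝ≥0) :
    LipschitzDoubling (lipschitzEnvelope ψ R) q R := by
  obtain ⟨hnn, heven, hconv, -, h0, hq, hdoub⟩ := h
  have hnn' : ∀ x, 0 ≤ lipschitzEnvelope ψ R x := fun x =>
    le_lipschitzEnvelope fun y => by have := hnn y; positivity
  refine ⟨hnn', fun r => ?_, ⟨convex_univ, ?_⟩, LipschitzWith.of_le_add_mul R fun x x' => ?_, ?_, hq,
    fun r l hl => ?_⟩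
  · have : ∀ r, lipschitzEnvelope ψ R (-r) ≤ lipschitzEnvelope ψ R r := fun r =>
      le_lipschitzEnvelope fun y => by
        have := lipschitzEnvelope_le hnn R (-r) (-y)
        rwa [heven, ← neg_sub_neg, neg_neg, neg_neg, abs_sub_comm] at this
    exact (this r).antisymm (by simpa using this (-r))
  · intro x _ u _ a b ha hb hab
    rw [lipschitzEnvelope.eq_def ψ R x, lipschitzEnvelope.eq_def ψ R u]
    simp only [smul_eq_mul]
    rw [Real.mul_iInf_of_nonneg ha, Real.mul_iInf_of_nonneg hb]
    refine le_ciInf_add_ciInf fun y z => ?_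
    refine (lipschitzEnvelope_le hnn R _ (a • y + b • z)).trans ?_
    have h1 := hconv.2 (mem_univ y) (mem_univ z) ha hb hab
    have h2 : |a * x + b * u - (a * y + b * z)| ≤ a * |x - y| + b * |u - z| := by
      rw [show a * x + b * u - (a * y + b * z) = a * (x - y) + b * (u - z) by ring]
      refine (abs_add_le _ _).trans_eq ?_
      rw [abs_mul, abs_mul, abs_of_nonneg ha, abs_of_nonneg hb]
    have h3 := mul_le_mul_of_nonneg_left h2 R.2
    simp only [smul_eq_mul, NNReal.val_eq_coe] at h1 h3 ⊢
    linarith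
  · rw [← sub_le_iff_le_add]
    refine le_lipschitzEnvelope fun y => ?_
    have h1 := lipschitzEnvelope_le hnn R x y
    have h2 := mul_le_mul_of_nonneg_left (abs_sub_le x x' y) R.2
    rw [Real.dist_eq]
    simp only [NNReal.val_eq_coe] at h2
    linarith
  · exact le_antisymm ((lipschitzEnvelope_le_self hnn R 0).trans_eq h0) (hnn' 0)
  · rw [lipschitzEnvelope.eq_def ψ R r, Real.mul_iInf_of_nonneg (by positivity)]
    refine le_ciInf fun y => (lipschitzEnvelope_le hnn R _ (l * y)).trans ?_
    rw [← mul_sub, abs_mul, abs_of_nonneg (by linarith), mul_add]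
    have h1 : l ≤ l ^ q := by
      simpa using Real.rpow_le_rpow_of_exponent_le hl hq
    have h2 := mul_le_mul_of_nonneg_right h1 (by positivity : 0 ≤ R * |r - y|)
    linarith [hdoub y l hl]

theorem AdmissibleDoubling.lipschitzEnvelope_eq (h : AdmissibleDoubling ψ q) {x : ℝ}
    (hR : |deriv ψ x| ≤ R) : lipschitzEnvelope ψ R x = ψ x := by
  obtain ⟨hnn, -, hconv, hdiff, -⟩ := h
  refine (lipschitzEnvelope_le_self hnn R x).antisymm (le_lipschitzEnvelope fun y => ?_)
  have hd := (hdiff.differentiable one_ne_zero x).hasDerivAt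
  have h1 : ψ x + deriv ψ x * (y - x) ≤ ψ y := by
    rcases lt_trichotomy x y with hy | rfl | hy
    · have := hconv.le_slope_of_hasDerivAt trivial trivial hy hd
      rw [slope_def_field, le_div_iff₀ (by linarith)] at this
      linarith
    · simp
    · have := hconv.slope_le_of_hasDerivAt trivial trivial hy hd
      rw [slope_def_field, div_le_iff₀ (by linarith)] at this
      linarith
  have h2 : -(deriv ψ x * (y - x)) ≤ R * |x - y| := by
    refine (neg_le_abs _).trans ?_
    rw [abs_mul, abs_sub_comm]
    gcongr
  linarith

theorem PsiL_mono {φ ψ : ℝ → ℝ} (h : ∀ x, φ x ≤ ψ x) (Z : L2) : PsiL φ Z ≤ PsiL ψ Z :=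
  lintegral_mono fun _ => ENNReal.ofReal_le_ofReal (h _)

theorem LipschitzDoubling.ofReal_integral (h : LipschitzDoubling ψ q R) (Z : L2) :
    ENNReal.ofReal (∫ m, ψ (Z m) ∂mu) = PsiL ψ Z :=
  ofReal_integral_eq_lintegral_ofReal (h.integrable Z) (Eventually.of_forall fun _ => h.nonneg _)

theorem AdmissibleDoubling.measurable_ofReal (h : AdmissibleDoubling ψ q) (Z : L2) :
    AEMeasurable (fun m => ENNReal.ofReal (ψ (Z m))) mu :=
  (h.2.2.2.1.continuous.measurable.comp_aemeasurable
    (Lp.aestronglyMeasurable Z).aemeasurable).ennreal_ofReal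

/-- `PsiL ψ` is controlled by the functionals of the Lipschitz envelopes of `ψ`. -/
theorem AdmissibleDoubling.add_le_of_envelope (h : AdmissibleDoubling ψ q) {X V : L2} {B : ℝ≥0∞}
    (hB : ∀ n : ℕ, PsiL (lipschitzEnvelope ψ n) X + PsiL (lipschitzEnvelope ψ n) V ≤ B) :
    PsiL ψ X + PsiL ψ V ≤ B := by
  have hmeas : ∀ (n : ℕ) (Z : L2),
      AEMeasurable (fun m => ENNReal.ofReal (lipschitzEnvelope ψ n (Z m))) mu := fun n Z =>
    ((h.lipschitzDoubling_envelope n).lipschitz.continuous.measurable.comp_aemeasurable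
      (Lp.aestronglyMeasurable Z).aemeasurable).ennreal_ofReal
  have hlim : ∀ x, Tendsto (fun n : ℕ => lipschitzEnvelope ψ n x) atTop (𝓝 (ψ x)) := fun x => by
    refine tendsto_const_nhds.congr' ?_
    filter_upwards [eventually_ge_atTop ⌈|deriv ψ x|⌉₊] with n hn
    refine (h.lipschitzEnvelope_eq ?_).symm
    exact (Nat.le_ceil _).trans (by exact_mod_cast hn)
  have hfatou := lintegral_liminf_le' (μ := mu) (u := atTop) fun n => (hmeas n X).add (hmeas n V)
  have heq : ∀ m, liminf (fun n : ℕ => ENNReal.ofReal (lipschitzEnvelope ψ n (X m)) +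
      ENNReal.ofReal (lipschitzEnvelope ψ n (V m))) atTop =
      ENNReal.ofReal (ψ (X m)) + ENNReal.ofReal (ψ (V m)) := fun m =>
    ((ENNReal.tendsto_ofReal (hlim _)).add (ENNReal.tendsto_ofReal (hlim _))).liminf_eq
  simp only [Pi.add_apply, heq] at hfatou
  rw [lintegral_add_left' (h.measurable_ofReal X)] at hfatou
  refine hfatou.trans (liminf_le_of_le (by isBoundedDefault) fun b hb => ?_)
  obtain ⟨n, hn⟩ := hb.exists
  refine hn.trans (le_trans (le_of_eq ?_) (hB n))
  exact lintegral_add_left' (hmeas n X) _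

end lipschitzEnvelope

theorem LagSol.psi_bound {F : L2 → L2} {Cp : ℝ} (hptw : PtwLinBdd F Cp) (hF : UnifCont F)
    {ψ : ℝ → ℝ} {q : ℝ} (hψ : AdmissibleDoubling ψ q) {T : ℝ} (hT : 0 ≤ T) :
    ∃ C : ℝ, 0 ≤ C ∧ ∀ Xbar Vbar : L2, ∀ X : ℝ → L2, LagSol F Xbar Vbar X →
      ∀ᵐ t ∂(volume.restrict (Icc (0 : ℝ) T)), ∀ V : L2, HasDerivAt X V t →
        PsiL ψ (X t) + PsiL ψ V ≤ ENNReal.ofReal C * (1 + PsiL ψ Xbar + PsiL ψ Vbar) := by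
  have hnn := hψ.1
  set D : ℝ := (max 1 (3 * Cp)) ^ q with hD
  have hD0 : 0 ≤ D := Real.rpow_nonneg (le_trans zero_le_one (le_max_left _ _)) _
  set k : ℝ := 2 ^ q with hk
  have hk0 : 0 ≤ k := by positivity
  set E := Real.exp (k * (2 + D) * T) with hE
  set A := k * (D * ψ 1) * T with hA
  have hA0 : 0 ≤ A := mul_nonneg (mul_nonneg hk0 (mul_nonneg hD0 (hnn 1))) hT
  refine ⟨(1 + A) * E, by positivity, fun Xbar Vbar X h => ?_⟩
  have hR : ∀ n : ℕ, ∀ᵐ t ∂(volume.restrict (Icc (0 : ℝ) T)), ∀ V : L2, HasDerivAt X V t →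
      PsiL (lipschitzEnvelope ψ n) (X t) + PsiL (lipschitzEnvelope ψ n) V ≤
        ENNReal.ofReal ((1 + A) * E) * (1 + PsiL ψ Xbar + PsiL ψ Vbar) := by
    intro n
    have hn := hψ.lipschitzDoubling_envelope n
    have hΦ0 : ∀ Z : L2, 0 ≤ ∫ m, lipschitzEnvelope ψ n (Z m) ∂mu := fun Z =>
      integral_nonneg fun m => hn.nonneg _
    have hbound := h.apriori_bound hF.continuousOn hn.lipschitzWith_integral hn.convexOn_integral
      hΦ0 hk0 (a := D * ψ 1) (b := D) (mul_nonneg hD0 (hnn 1)) hD0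
      (fun x v => by linarith [hn.integral_add_le x v, hΦ0 x])
      (fun Z hZ => (hn.integral_force_le hptw hZ).trans (by
        gcongr
        exact lipschitzEnvelope_le_self hnn n 1))
      (fun X V Y t ht hX hV hW => hn.integral_deriv_le ht hX hV hW) T
    filter_upwards [hbound] with t ht V hV
    have h1 := ENNReal.ofReal_le_ofReal (ht V hV)
    rw [ENNReal.ofReal_add (hΦ0 _) (hΦ0 _), hn.ofReal_integral, hn.ofReal_integral] at h1
    refine h1.trans ?_
    have h2 : (∫ m, lipschitzEnvelope ψ n (Xbar m) ∂mu + ∫ m, lipschitzEnvelope ψ n (Vbar m) ∂mu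
        + A) * E ≤ ((1 + A) * E) * (1 + ∫ m, lipschitzEnvelope ψ n (Xbar m) ∂mu +
        ∫ m, lipschitzEnvelope ψ n (Vbar m) ∂mu) := by
      have h3 := hΦ0 Xbar
      have h4 := hΦ0 Vbar
      have h5 : 0 ≤ E := by positivity
      rw [mul_right_comm]
      refine mul_le_mul_of_nonneg_right ?_ h5
      nlinarith
    refine (ENNReal.ofReal_le_ofReal h2).trans ?_
    have h0 := hΦ0 Xbar
    rw [ENNReal.ofReal_mul (by positivity), ENNReal.ofReal_add (by positivity) (hΦ0 _),
      ENNReal.ofReal_add zero_le_one (hΦ0 _), hn.ofReal_integral, hn.ofReal_integral,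
      ENNReal.ofReal_one]
    gcongr <;> exact PsiL_mono (lipschitzEnvelope_le_self hnn n) _
  filter_upwards [ae_all_iff.mpr hR] with t ht V hV
  exact hψ.add_le_of_envelope fun n => ht n V hV

/-- A Helly selection principle for uniformly bounded monotone functions. -/
theorem exists_subseq_tendsto_ae_of_monotone {g : ℕ → ℝ → ℝ} (hg : ∀ n, Monotone (g n)) {M : ℝ}
    (hM : ∀ n x, |g n x| ≤ M) : ∃ G : ℝ → ℝ, Monotone G ∧ ∃ φ : ℕ → ℕ, StrictMono φ ∧
      ∀ᵐ x ∂(volume : Measure ℝ), Tendsto (fun n => g (φ n) x) atTop (𝓝 (G x)) := by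
  obtain ⟨l, -, φ, hφ, hl⟩ := (isCompact_univ_pi fun _ : ℚ => isCompact_Icc (a := -M) (b := M))
    |>.tendsto_subseq (x := fun n (r : ℚ) => g n r) fun n r _ => abs_le.mp (hM n r)
  rw [tendsto_pi_nhds] at hl
  have hl' : ∀ r : ℚ, Tendsto (fun n => g (φ n) r) atTop (𝓝 (l r)) := hl
  have hlM : ∀ r, l r ≤ M := fun r =>
    le_of_tendsto (hl' r) (Eventually.of_forall fun n => (abs_le.mp (hM _ _)).2)
  have hne : ∀ x : ℝ, (l '' {r : ℚ | (r : ℝ) < x}).Nonempty := fun x => by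
    obtain ⟨r, hr⟩ := exists_rat_lt x
    exact ⟨_, r, hr, rfl⟩
  have hbdd : ∀ x : ℝ, BddAbove (l '' {r : ℚ | (r : ℝ) < x}) := fun x =>
    ⟨M, by rintro _ ⟨r, -, rfl⟩; exact hlM r⟩
  set G : ℝ → ℝ := fun x => sSup (l '' {r : ℚ | (r : ℝ) < x}) with hG
  have hGm : Monotone G := fun x y hxy =>
    csSup_le_csSup (hbdd y) (hne x) (image_mono fun r hr => lt_of_lt_of_le hr hxy)
  refine ⟨G, hGm, φ, hφ, ?_⟩
  filter_upwards [hGm.countable_not_continuousAt.ae_notMem volume] with x hx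
  have hcont : ContinuousAt G x := not_not.mp hx
  rw [tendsto_order]
  constructor
  · intro a ha
    obtain ⟨_, ⟨r, hr, rfl⟩, har⟩ := exists_lt_of_lt_csSup (hne x) ha
    filter_upwards [(tendsto_order.mp (hl' r)).1 a har] with n hn
    exact hn.trans_le (hg _ (le_of_lt hr))
  · intro a ha
    obtain ⟨y, hy, hxy⟩ := ((hcont.eventually (gt_mem_nhds ha)).filter_mono
      (nhdsWithin_le_nhds (s := Ioi x)) |>.and self_mem_nhdsWithin).exists
    obtain ⟨r, hxr, hry⟩ := exists_rat_btwn (show x < y from hxy)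
    have h1 : l r < a := (le_csSup (hbdd y) ⟨r, hry, rfl⟩).trans_lt hy
    filter_upwards [(tendsto_order.mp (hl' r)).2 a h1] with n hn
    exact (hg _ hxr.le).trans_lt hn

theorem exists_monotone_rep {X : L2} (hX : X ∈ Kcone) {M : ℝ≥0} (hM : ∀ᵐ m ∂mu, |X m| ≤ M) :
    ∃ g : ℝ → ℝ, Monotone g ∧ (∀ x, |g x| ≤ M) ∧ X =ᵐ[mu] g := by
  obtain ⟨h, hh, hXh⟩ := hX
  have hmono : ∀ a b : ℝ, a ≤ b → max (-(M : ℝ)) (min a M) ≤ max (-(M : ℝ)) (min b M) :=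
    fun a b hab => by gcongr
  have hM0 : (0 : ℝ) ≤ M := M.2
  have hle : ∀ a : ℝ, max (-(M : ℝ)) (min a M) ≤ M := fun a =>
    max_le (by linarith) (min_le_right _ _)
  obtain ⟨g, hg, hgh⟩ := MonotoneOn.exists_monotone_extension
    (f := fun x => max (-(M : ℝ)) (min (h x) M)) (s := Omg)
    (fun a ha b hb hab => hmono _ _ (hh ha hb hab))
    ⟨-M, by rintro _ ⟨x, -, rfl⟩; exact le_max_left _ _⟩
    ⟨M, by rintro _ ⟨x, -, rfl⟩; exact hle _⟩
  refine ⟨fun x => max (-(M : ℝ)) (min (g x) M), fun a b hab => hmono _ _ (hg hab),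
    fun x => abs_le.mpr ⟨le_max_left _ _, hle _⟩, ?_⟩
  filter_upwards [hXh, hM, ae_mem_Omg] with m h1 h2 h3
  have h4 := abs_le.mp h2
  have h5 := hgh h3
  simp only [← h1] at h5
  rw [min_eq_left h4.2, max_eq_right h4.1] at h5
  rw [← h5, min_eq_left h4.2, max_eq_right h4.1]

/-- Dominated convergence in `L²`. -/
theorem tendsto_of_tendsto_ae_of_abs_sub_le {X : ℕ → L2} {Z D : L2}
    (hX : ∀ n, ∀ᵐ m ∂mu, |X n m - Z m| ≤ |D m|)
    (hlim : ∀ᵐ m ∂mu, Tendsto (fun n => X n m) atTop (𝓝 (Z m))) : Tendsto X atTop (𝓝 Z) := by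
  rw [tendsto_iff_norm_sub_tendsto_zero]
  have hint : Tendsto (fun n => ∫ m, ⟪(X n - Z) m, (X n - Z) m⟫ ∂mu) atTop
      (𝓝 (∫ _, (0 : ℝ) ∂mu)) := by
    refine tendsto_integral_of_dominated_convergence (fun m => ⟪D m, D m⟫)
      (fun n => (L2.integrable_inner (𝕜 := ℝ) _ _).aestronglyMeasurable)
      (L2.integrable_inner (𝕜 := ℝ) _ _) (fun n => ?_) ?_
    · filter_upwards [hX n, Lp.coeFn_sub (X n) Z] with m h1 h2
      rw [h2, real_inner_self_eq_norm_sq, real_inner_self_eq_norm_sq, norm_pow, norm_norm]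
      exact pow_le_pow_left₀ (norm_nonneg _) h1 2
    · filter_upwards [hlim, ae_all_iff.mpr fun n => Lp.coeFn_sub (X n) Z] with m h1 h2
      simp only [h2, real_inner_self_eq_norm_sq, Pi.sub_apply]
      simpa using (tendsto_iff_norm_sub_tendsto_zero.mp h1).pow 2
  have h1 : ∀ n, ∫ m, ⟪(X n - Z) m, (X n - Z) m⟫ ∂mu = ‖X n - Z‖ ^ 2 := fun n => by
    rw [← L2.inner_def, real_inner_self_eq_norm_sq]
  simp only [h1, integral_zero] at hint
  simpa [Real.sqrt_sq] using hint.sqrt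

theorem isCompact_Kcone_inter_bounded (M : ℝ≥0) :
    IsCompact {X : L2 | X ∈ Kcone ∧ ∀ᵐ m ∂mu, |X m| ≤ M} := by
  rw [isCompact_iff_isSeqCompact]
  intro X hX
  choose g hg hgM hXg using fun n => exists_monotone_rep (hX n).1 (hX n).2
  obtain ⟨G, hG, φ, hφ, hlim⟩ := exists_subseq_tendsto_ae_of_monotone hg hgM
  have hlim' : ∀ᵐ m ∂mu, Tendsto (fun n => g (φ n) m) atTop (𝓝 (G m)) := ae_restrict_of_ae hlim
  have hGM : ∀ᵐ m ∂mu, |G m| ≤ M := by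
    filter_upwards [hlim'] with m hm
    exact le_of_tendsto hm.abs (Eventually.of_forall fun n => hgM _ _)
  have hGL : MemLp G 2 mu := MemLp.of_bound hG.measurable.aestronglyMeasurable M hGM
  have hGe := hGL.coeFn_toLp
  have hZ : ∀ᵐ m ∂mu, |hGL.toLp G m| ≤ M := by
    filter_upwards [hGM, hGe] with m h1 h2
    rwa [h2]
  refine ⟨hGL.toLp G, ⟨⟨G, hG.monotoneOn _, hGe⟩, hZ⟩, φ, hφ, ?_⟩
  refine tendsto_of_tendsto_ae_of_abs_sub_le (D := Lp.const 2 mu (2 * M : ℝ)) (fun n => ?_) ?_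
  · filter_upwards [(hX (φ n)).2, hZ, Lp.coeFn_const 2 mu (2 * M : ℝ)] with m h1 h2 h3
    rw [h3]
    refine (abs_sub _ _).trans (le_trans ?_ (le_abs_self _))
    simp only [Function.comp_apply, Function.const_apply]
    linarith
  filter_upwards [hlim', hGe, ae_all_iff.mpr hXg] with m h1 h2 h3
  simp only [Function.comp_apply, h2, h3]
  exact h1

/-- Truncation of an `L²` function at level `M`. -/
theorem exists_truncation (Z : L2) (M : ℝ≥0) :
    ∃ U : L2, ∀ᵐ m ∂mu, U m = max (-(M : ℝ)) (min (Z m) M) := by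
  have hL : LipschitzWith 1 fun x : ℝ => max (-(M : ℝ)) (min x M) :=
    (LipschitzWith.id.min_const _).const_max _
  have h0 : (fun x : ℝ => max (-(M : ℝ)) (min x M)) 0 = 0 := by simp
  exact ⟨hL.compLp h0 Z, hL.coeFn_compLp h0 Z⟩

/-- `Z` lies within `ε` of a function bounded by `M`. -/
def NearBounded (Z : L2) (M ε : ℝ) : Prop :=
  ∃ U : L2, (∀ᵐ m ∂mu, |U m| ≤ M) ∧ ‖Z - U‖ ≤ ε

theorem abs_sub_truncation_le {M x y : ℝ} (hy : |y| ≤ M) :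
    |x - max (-M) (min x M)| ≤ |x - y| := by
  have := abs_le.mp hy
  rcases le_total x M with h | h
  · rw [min_eq_left h]
    rcases le_total (-M) x with h' | h'
    · rw [max_eq_right h']; simp
    · rw [max_eq_left h', abs_of_nonpos (by linarith), abs_of_nonpos (by linarith)]; linarith
  · rw [min_eq_right h, max_eq_right (by linarith), abs_of_nonneg (by linarith),
      abs_of_nonneg (by linarith)]; linarith

theorem abs_truncation_le (M : ℝ≥0) (x : ℝ) : |max (-(M : ℝ)) (min x M)| ≤ M :=
  abs_le.mpr ⟨le_max_left _ _, max_le (by linarith [M.coe_nonneg]) (min_le_right _ _)⟩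

theorem norm_sub_truncation_le {Z U W : L2} {M : ℝ≥0} (hU : ∀ᵐ m ∂mu, |U m| ≤ M)
    (hW : ∀ᵐ m ∂mu, W m = max (-(M : ℝ)) (min (Z m) M)) : ‖Z - W‖ ≤ ‖Z - U‖ := by
  refine Lp.norm_le_norm_of_ae_le ?_
  filter_upwards [hU, hW, Lp.coeFn_sub Z W, Lp.coeFn_sub Z U] with m h1 h2 h3 h4
  rw [h3, h4, Pi.sub_apply, Pi.sub_apply, h2]
  exact abs_sub_truncation_le h1

theorem truncation_mem_Kcone {Z W : L2} (hZ : Z ∈ Kcone) {M : ℝ}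
    (hW : ∀ᵐ m ∂mu, W m = max (-M) (min (Z m) M)) : W ∈ Kcone :=
  mem_Kcone_of_comp hZ hZ (G := fun x _ => max (-M) (min x M))
    (fun _ _ _ _ h _ => by gcongr) hW

/-- Functions in the cone that are uniformly approximable by bounded functions form a relatively
compact set. -/
theorem isCompact_closure_of_nearBounded {S : Set L2} (hS : S ⊆ Kcone)
    (h : ∀ ε > 0, ∃ M : ℝ≥0, ∀ Z ∈ S, NearBounded Z M ε) : IsCompact (closure S) := by
  refine TotallyBounded.isCompact_of_isClosed (TotallyBounded.closure ?_) isClosed_closure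
  rw [Metric.totallyBounded_iff]
  intro ε hε
  obtain ⟨M, hM⟩ := h (ε / 2) (by positivity)
  obtain ⟨t, ht, hcov⟩ := Metric.totallyBounded_iff.mp
    (isCompact_Kcone_inter_bounded M).totallyBounded (ε / 2) (by positivity)
  refine ⟨t, ht, fun Z hZ => ?_⟩
  obtain ⟨U, hU, hZU⟩ := hM Z hZ
  obtain ⟨W, hW⟩ := exists_truncation Z M
  have hWmem : W ∈ {X : L2 | X ∈ Kcone ∧ ∀ᵐ m ∂mu, |X m| ≤ M} := by
    refine ⟨truncation_mem_Kcone (hS hZ) hW, ?_⟩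
    filter_upwards [hW] with m hm
    rw [hm]
    exact abs_truncation_le M _
  obtain ⟨y, hy, hWy⟩ := mem_iUnion₂.mp (hcov hWmem)
  refine mem_iUnion₂.mpr ⟨y, hy, ?_⟩
  rw [Metric.mem_ball, dist_eq_norm] at *
  have h1 := (norm_sub_truncation_le hU hW).trans hZU
  have h2 := norm_sub_le_norm_sub_add_norm_sub Z W y
  linarith

/-- Every function is approximable by bounded functions. -/
theorem exists_nearBounded (Z : L2) {ε : ℝ} (hε : 0 < ε) :
    ∃ M₀ : ℝ, ∀ M ≥ M₀, NearBounded Z M ε := by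
  choose U hU using fun n : ℕ => exists_truncation Z n
  have hlim : Tendsto U atTop (𝓝 Z) := by
    refine tendsto_of_tendsto_ae_of_abs_sub_le (D := Z) (fun n => ?_) ?_
    · filter_upwards [hU n] with m hm
      rw [hm, abs_sub_comm]
      simpa using abs_sub_truncation_le (x := Z m) (M := ((n : ℝ≥0) : ℝ)) (y := 0) (by simp)
    · filter_upwards [ae_all_iff.mpr hU] with m hm
      refine tendsto_const_nhds.congr' ?_
      filter_upwards [eventually_ge_atTop ⌈|Z m|⌉₊] with n hn
      have h1 := abs_le.mp ((Nat.le_ceil |Z m|).trans (by exact_mod_cast hn : _ ≤ (n : ℝ)))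
      rw [hm, NNReal.coe_natCast, min_eq_left h1.2, max_eq_right h1.1]
  obtain ⟨n, hn⟩ := (Metric.tendsto_atTop.mp hlim ε hε)
  refine ⟨n, fun M hM => ⟨U n, ?_, ?_⟩⟩
  · filter_upwards [hU n] with m hm
    rw [hm]
    exact (abs_truncation_le n _).trans (by simpa using hM)
  · rw [← dist_eq_norm, dist_comm]
    exact (hn n le_rfl).le

theorem exists_projection_Kcone (Z : L2) :
    ∃ P ∈ Kcone, ∀ U ∈ Kcone, ⟪Z - P, U - P⟫ ≤ 0 := by
  obtain ⟨P, hP, hmin⟩ := exists_norm_eq_iInf_of_complete_convex ⟨0, zero_mem_Kcone⟩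
    isClosed_Kcone.isComplete convex_Kcone Z
  exact ⟨P, hP, (norm_eq_iInf_iff_real_inner_le_zero convex_Kcone hP).mp hmin⟩

/-- The metric projection onto the cone. -/
def projK (Z : L2) : L2 := (exists_projection_Kcone Z).choose

theorem projK_mem (Z : L2) : projK Z ∈ Kcone := (exists_projection_Kcone Z).choose_spec.1

theorem inner_projK_le (Z : L2) {U : L2} (hU : U ∈ Kcone) : ⟪Z - projK Z, U - projK Z⟫ ≤ 0 :=
  (exists_projection_Kcone Z).choose_spec.2 U hU

theorem projK_eq_of_norm_le {Z U : L2} (hU : U ∈ Kcone) (h : ‖Z - U‖ ≤ ‖Z - projK Z‖) :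
    projK Z = U := by
  have h1 := inner_projK_le Z hU
  have h2 := norm_sub_sq_real (Z - projK Z) (U - projK Z)
  rw [sub_sub_sub_cancel_right] at h2
  have h3 := pow_le_pow_left₀ (norm_nonneg _) h 2
  have h4 : ‖U - projK Z‖ ^ 2 ≤ 0 := by linarith
  have h5 : U - projK Z = 0 := by
    rw [← norm_eq_zero]
    exact pow_eq_zero_iff two_ne_zero |>.mp (h4.antisymm (sq_nonneg _))
  exact (sub_eq_zero.mp h5).symm

theorem projK_eq_self {Z : L2} (hZ : Z ∈ Kcone) : projK Z = Z :=
  projK_eq_of_norm_le hZ (by simp)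

theorem norm_projK_sub_le (Z U : L2) : ‖projK Z - projK U‖ ≤ ‖Z - U‖ := by
  have h1 := inner_projK_le Z (projK_mem U)
  have h2 := inner_projK_le U (projK_mem Z)
  set P := projK Z
  set Q := projK U
  have h3 : ‖P - Q‖ ^ 2 ≤ ⟪Z - U, P - Q⟫ := by
    have h4 : ⟪Z - P, Q - P⟫ + ⟪U - Q, P - Q⟫ = ⟪P - Q, P - Q⟫ - ⟪Z - U, P - Q⟫ := by
      rw [← neg_sub P Q, inner_neg_right, ← sub_eq_neg_add, ← inner_sub_left, ← inner_sub_left]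
      congr 1
      abel
    rw [real_inner_self_eq_norm_sq] at h4
    linarith
  have h5 := real_inner_le_norm (Z - U) (P - Q)
  rcases (norm_nonneg (P - Q)).eq_or_lt with h6 | h6
  · rw [← h6]; positivity
  · nlinarith

theorem norm_projK_le (Z : L2) : ‖projK Z‖ ≤ ‖Z‖ := by
  simpa [projK_eq_self zero_mem_Kcone] using norm_projK_sub_le Z 0

theorem abs_projK_le {Z : L2} {M : ℝ} (h : ∀ᵐ m ∂mu, |Z m| ≤ M) :
    ∀ᵐ m ∂mu, |projK Z m| ≤ M := by
  obtain ⟨m, hm⟩ := h.exists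
  lift M to ℝ≥0 using (abs_nonneg _).trans hm
  obtain ⟨W, hW⟩ := exists_truncation (projK Z) M
  have h1 : projK Z = W := by
    refine projK_eq_of_norm_le (truncation_mem_Kcone (projK_mem Z) hW) ?_
    refine Lp.norm_le_norm_of_ae_le ?_
    filter_upwards [h, hW, Lp.coeFn_sub Z W, Lp.coeFn_sub Z (projK Z)] with m h1 h2 h3 h4
    rw [h3, h4, Pi.sub_apply, Pi.sub_apply, h2]
    have h5 := abs_le.mp h1
    have hmax := (LipschitzWith.id.min_const (M : ℝ)).const_max (-(M : ℝ)) |>.dist_le_mul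
      (Z m) (projK Z m)
    simpa [Real.dist_eq, min_eq_left h5.2, max_eq_right h5.1] using hmax
  filter_upwards [hW] with m hm
  rw [h1, hm]
  exact abs_truncation_le M _

theorem NearBounded.mono {Z : L2} {M ε M' ε' : ℝ} (h : NearBounded Z M ε) (hM : M ≤ M')
    (hε : ε ≤ ε') : NearBounded Z M' ε' := by
  obtain ⟨U, hU, hZU⟩ := h
  exact ⟨U, hU.mono fun m hm => hm.trans hM, hZU.trans hε⟩

theorem NearBounded.projK {Z : L2} {M ε : ℝ} (h : NearBounded Z M ε) :
    NearBounded (projK Z) M ε := by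
  obtain ⟨U, hU, hZU⟩ := h
  exact ⟨_, abs_projK_le hU, (norm_projK_sub_le Z U).trans hZU⟩

theorem NearBounded.add_smul {Z W : L2} {M ε N δ τ : ℝ} (hZ : NearBounded Z M ε)
    (hW : NearBounded W N δ) (hτ : 0 ≤ τ) : NearBounded (Z + τ • W) (M + τ * N) (ε + τ * δ) := by
  obtain ⟨U, hU, hZU⟩ := hZ
  obtain ⟨V, hV, hWV⟩ := hW
  refine ⟨U + τ • V, ?_, ?_⟩
  · filter_upwards [hU, hV, Lp.coeFn_add U (τ • V), Lp.coeFn_smul τ V] with m h1 h2 h3 h4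
    rw [h3, Pi.add_apply, h4, Pi.smul_apply, smul_eq_mul]
    refine (abs_add_le _ _).trans ?_
    rw [abs_mul, abs_of_nonneg hτ]
    gcongr
  · rw [add_sub_add_comm, ← smul_sub]
    refine (norm_add_le _ _).trans ?_
    rw [norm_smul, Real.norm_of_nonneg hτ]
    gcongr

theorem NearBounded.force {F : L2 → L2} {Cp : ℝ} (hF : PtwLinBdd F Cp) {Z : L2}
    (hZ : Z ∈ Kcone) {M ε B : ℝ} (h : NearBounded Z M ε) (hM : 0 ≤ M) (hB : ‖Z‖ ≤ B) :
    NearBounded (F Z) (Cp * (1 + M + B)) (Cp * ε) := by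
  obtain ⟨U, hU, hZU⟩ := h
  have hCp := hF.1
  have hB0 := (norm_nonneg Z).trans hB
  have hN0 : 0 ≤ Cp * (1 + M + B) := by positivity
  obtain ⟨W, hW⟩ := exists_truncation (F Z) (Cp * (1 + M + B)).toNNReal
  refine ⟨W, ?_, ?_⟩
  · filter_upwards [hW] with m hm
    rw [hm]
    exact (abs_truncation_le _ _).trans_eq (Real.coe_toNNReal _ hN0)
  · rw [Real.coe_toNNReal _ hN0] at hW
    refine (Lp.norm_le_mul_norm_of_ae_le_mul (g := Z - U) ?_).trans
      (mul_le_mul_of_nonneg_left hZU hCp)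
    filter_upwards [hF.2 Z hZ, hU, hW, Lp.coeFn_sub (F Z) W, Lp.coeFn_sub Z U]
      with m h1 h2 h3 h4 h5
    rw [h4, h5, Pi.sub_apply, Pi.sub_apply, h3, Real.norm_eq_abs, Real.norm_eq_abs]
    have h6 : |F Z m| ≤ Cp * (1 + M + B) + Cp * |Z m - U m| := by
      rw [← mul_add]
      refine h1.trans (mul_le_mul_of_nonneg_left ?_ hCp)
      have h7 := abs_sub_abs_le_abs_sub (Z m) (U m)
      linarith [integral_abs_le_norm Z]
    have h8 : 0 ≤ Cp * |Z m - U m| := by positivity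
    have h9 := abs_le.mp h6
    rcases le_total (F Z m) (Cp * (1 + M + B)) with h | h
    · rw [min_eq_left h]
      rcases le_total (-(Cp * (1 + M + B))) (F Z m) with h' | h'
      · rw [max_eq_right h', sub_self, abs_zero]; exact h8
      · rw [max_eq_left h']; exact abs_le.mpr ⟨by linarith, by linarith⟩
    · rw [min_eq_right h, max_eq_right (by linarith)]
      exact abs_le.mpr ⟨by linarith, by linarith⟩

/-- The projected Euler scheme with time step `τ`. -/
def euler (F : L2 → L2) (Xbar Vbar : L2) (τ : ℝ) : ℕ → L2 × L2
  | 0 => (Xbar, Vbar)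
  | k + 1 => (projK ((euler F Xbar Vbar τ k).1 + τ • (euler F Xbar Vbar τ k).2),
      (euler F Xbar Vbar τ k).2 + τ • F (euler F Xbar Vbar τ k).1)

section euler

variable {F : L2 → L2} {Xbar Vbar : L2} {τ : ℝ}

theorem euler_succ_fst (k : ℕ) : (euler F Xbar Vbar τ (k + 1)).1 =
    projK ((euler F Xbar Vbar τ k).1 + τ • (euler F Xbar Vbar τ k).2) := rfl

theorem euler_succ_snd (k : ℕ) : (euler F Xbar Vbar τ (k + 1)).2 =
    (euler F Xbar Vbar τ k).2 + τ • F (euler F Xbar Vbar τ k).1 := rfl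

theorem euler_mem (hX : Xbar ∈ Kcone) : ∀ k, (euler F Xbar Vbar τ k).1 ∈ Kcone
  | 0 => hX
  | _ + 1 => projK_mem _

theorem exp_step_le {A : ℝ} (k : ℕ) :
    (1 + A * τ) * Real.exp (A * (k * τ)) ≤ Real.exp (A * ((k + 1 : ℕ) * τ)) := by
  have h1 : A * ((k + 1 : ℕ) * τ) = A * τ + A * (k * τ) := by push_cast; ring
  rw [h1, Real.exp_add]
  exact mul_le_mul_of_nonneg_right (by linarith [Real.add_one_le_exp (A * τ)]) (Real.exp_nonneg _)

theorem euler_norm_le {C : ℝ} (hC : 0 ≤ C) (hF : ∀ X ∈ Kcone, ‖F X‖ ≤ C * (1 + ‖X‖))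
    (hX : Xbar ∈ Kcone) (hτ : 0 ≤ τ) (k : ℕ) :
    1 + ‖(euler F Xbar Vbar τ k).1‖ + ‖(euler F Xbar Vbar τ k).2‖ ≤
      Real.exp ((1 + C) * (k * τ)) * (1 + ‖Xbar‖ + ‖Vbar‖) := by
  induction k with
  | zero => simp [euler]
  | succ k ih =>
    rw [euler_succ_fst, euler_succ_snd]
    set x := (euler F Xbar Vbar τ k).1 with hx
    set y := (euler F Xbar Vbar τ k).2
    have h1 : ‖projK (x + τ • y)‖ ≤ ‖x‖ + τ * ‖y‖ := by
      refine (norm_projK_le _).trans ((norm_add_le _ _).trans_eq ?_)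
      rw [norm_smul, Real.norm_of_nonneg hτ]
    have h2 : ‖y + τ • F x‖ ≤ ‖y‖ + τ * (C * (1 + ‖x‖)) := by
      refine (norm_add_le _ _).trans ?_
      rw [norm_smul, Real.norm_of_nonneg hτ]
      have := hF x (euler_mem hX k)
      gcongr
    have h3 : 1 + ‖projK (x + τ • y)‖ + ‖y + τ • F x‖ ≤
        (1 + (1 + C) * τ) * (1 + ‖x‖ + ‖y‖) := by
      have h4 : 0 ≤ τ * (1 + ‖x‖) := by positivity
      have h5 : 0 ≤ C * τ * ‖y‖ := by positivity
      nlinarith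
    refine h3.trans ((mul_le_mul_of_nonneg_left ih (by positivity)).trans ?_)
    rw [← mul_assoc]
    exact mul_le_mul_of_nonneg_right (exp_step_le k) (by positivity)

theorem exists_euler_bound (hF : UnifCont F) (hX : Xbar ∈ Kcone) (Vbar : L2) (T : ℝ) :
    ∃ L : ℝ≥0, ∀ τ : ℝ, 0 ≤ τ → ∀ k : ℕ, k * τ ≤ T → ‖(euler F Xbar Vbar τ k).1‖ ≤ L ∧
      ‖(euler F Xbar Vbar τ k).2‖ ≤ L ∧ ‖F (euler F Xbar Vbar τ k).1‖ ≤ L := by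
  obtain ⟨C, hC, hFC⟩ := hF.1
  have hS : 0 ≤ Real.exp ((1 + C) * T) * (1 + ‖Xbar‖ + ‖Vbar‖) := by positivity
  refine ⟨⟨(1 + C) * (Real.exp ((1 + C) * T) * (1 + ‖Xbar‖ + ‖Vbar‖)), by positivity⟩,
    fun τ hτ k hk => ?_⟩
  have h1 := euler_norm_le (Vbar := Vbar) hC hFC hX hτ k
  have h2 : Real.exp ((1 + C) * (k * τ)) * (1 + ‖Xbar‖ + ‖Vbar‖) ≤
      Real.exp ((1 + C) * T) * (1 + ‖Xbar‖ + ‖Vbar‖) := by gcongr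
  have h3 := hFC _ (euler_mem (F := F) (Vbar := Vbar) (τ := τ) hX k)
  set x := (euler F Xbar Vbar τ k).1
  set y := (euler F Xbar Vbar τ k).2
  set S := Real.exp ((1 + C) * T) * (1 + ‖Xbar‖ + ‖Vbar‖)
  have h4 := norm_nonneg x
  have h5 := norm_nonneg y
  have h6 : 0 ≤ C * S := by positivity
  change ‖x‖ ≤ (1 + C) * S ∧ ‖y‖ ≤ (1 + C) * S ∧ ‖F x‖ ≤ (1 + C) * S
  refine ⟨by linarith, by linarith, h3.trans ?_⟩
  have h7 : C * (1 + ‖x‖) ≤ C * S := mul_le_mul_of_nonneg_left (by linarith) hC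
  linarith

theorem euler_nearBounded {Cp : ℝ} (hF : PtwLinBdd F Cp) (hX : Xbar ∈ Kcone) (hτ : 0 ≤ τ)
    {T B M ε : ℝ} (hB : ∀ k : ℕ, k * τ ≤ T → ‖(euler F Xbar Vbar τ k).1‖ ≤ B) (hB0 : 0 ≤ B)
    (hM : 1 + B ≤ M) (hε : 0 ≤ ε) (hXM : NearBounded Xbar M ε) (hVM : NearBounded Vbar M ε)
    (k : ℕ) (hk : k * τ ≤ T) :
    NearBounded (euler F Xbar Vbar τ k).1 (Real.exp ((1 + 2 * Cp) * (k * τ)) * M)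
      (Real.exp ((1 + 2 * Cp) * (k * τ)) * ε) ∧
    NearBounded (euler F Xbar Vbar τ k).2 (Real.exp ((1 + 2 * Cp) * (k * τ)) * M)
      (Real.exp ((1 + 2 * Cp) * (k * τ)) * ε) := by
  induction k with
  | zero => simpa [euler] using ⟨hXM, hVM⟩
  | succ k ih =>
    have hkT : k * τ ≤ T := le_trans (by push_cast; linarith) hk
    obtain ⟨ih1, ih2⟩ := ih hkT
    have hCp := hF.1
    have hM0 : 0 ≤ M := by linarith
    have hstep := exp_step_le (τ := τ) (A := 1 + 2 * Cp) k
    have hG1 : 1 ≤ Real.exp ((1 + 2 * Cp) * (k * τ)) := Real.one_le_exp (by positivity)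
    set G := Real.exp ((1 + 2 * Cp) * (k * τ))
    set G' := Real.exp ((1 + 2 * Cp) * ((k + 1 : ℕ) * τ))
    have hGM : 1 + B ≤ G * M := hM.trans (le_mul_of_one_le_left hM0 hG1)
    have hforce := ih1.force hF (euler_mem hX k) (by positivity) (hB k hkT)
    have hmul : ∀ z, 0 ≤ z → (1 + (1 + 2 * Cp) * τ) * (G * z) ≤ G' * z := fun z hz => by
      rw [← mul_assoc]; exact mul_le_mul_of_nonneg_right hstep hz
    have hm1 := hmul M hM0
    have hm2 := hmul ε hε
    have hGε : 0 ≤ G * ε := by positivity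
    have h1 : 0 ≤ Cp * τ * (G * M) := by positivity
    have h2 : 0 ≤ Cp * τ * (G * ε) := by positivity
    have h3 : 0 ≤ τ * (G * M) := by positivity
    have h4 : 0 ≤ τ * (G * ε) := by positivity
    rw [euler_succ_fst, euler_succ_snd]
    refine ⟨((ih1.add_smul ih2 hτ).mono ?_ ?_).projK, (ih2.add_smul hforce hτ).mono ?_ ?_⟩
    · linarith
    · linarith
    · have h5 : τ * (Cp * (1 + G * M + B)) ≤ τ * (Cp * (2 * (G * M))) := by
        gcongr; linarith
      linarith
    · linarith

theorem exists_compact_euler {Cp : ℝ} (hptw : PtwLinBdd F Cp) (hF : UnifCont F)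
    (hX : Xbar ∈ Kcone) (Vbar : L2) (T : ℝ) : ∃ Q : Set L2, IsCompact Q ∧ Q ⊆ Kcone ∧
      ∀ τ : ℝ, 0 ≤ τ → ∀ k : ℕ, k * τ ≤ T → (euler F Xbar Vbar τ k).1 ∈ Q := by
  obtain ⟨L, hL⟩ := exists_euler_bound hF hX Vbar T
  set S : Set L2 := {Z | ∃ τ : ℝ, 0 ≤ τ ∧ ∃ k : ℕ, k * τ ≤ T ∧ (euler F Xbar Vbar τ k).1 = Z}
  have hS : S ⊆ Kcone := by rintro _ ⟨τ, -, k, -, rfl⟩; exact euler_mem hX k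
  refine ⟨closure S, isCompact_closure_of_nearBounded hS fun ε hε => ?_,
    closure_minimal hS isClosed_Kcone, fun τ hτ k hk => subset_closure ⟨τ, hτ, k, hk, rfl⟩⟩
  have hCp := hptw.1
  set G := Real.exp ((1 + 2 * Cp) * T)
  have hG : 0 < G := Real.exp_pos _
  obtain ⟨M₁, hM₁⟩ := exists_nearBounded Xbar (show 0 < ε / G by positivity)
  obtain ⟨M₂, hM₂⟩ := exists_nearBounded Vbar (show 0 < ε / G by positivity)
  set M := max (1 + (L : ℝ)) (max M₁ M₂)
  have hM : 1 + (L : ℝ) ≤ M := le_max_left _ _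
  have hM0 : 0 ≤ M := le_trans (by positivity) hM
  refine ⟨⟨G * M, by positivity⟩, ?_⟩
  rintro _ ⟨τ, hτ, k, hk, rfl⟩
  have hexp : Real.exp ((1 + 2 * Cp) * (k * τ)) ≤ G :=
    Real.exp_le_exp.mpr (mul_le_mul_of_nonneg_left hk (by positivity))
  refine (euler_nearBounded hptw hX hτ (fun k hk => (hL τ hτ k hk).1) L.2 hM (by positivity)
    (hM₁ M (le_trans (le_max_left _ _) (le_max_right _ _)))
    (hM₂ M (le_trans (le_max_right _ _) (le_max_right _ _))) k hk).1.mono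
    (mul_le_mul_of_nonneg_right hexp hM0) ?_
  refine (mul_le_mul_of_nonneg_right hexp (by positivity)).trans_eq ?_
  field_simp

/-- Along a sequence whose increments are bounded by `L * τ`, distances grow at most linearly. -/
theorem norm_sub_le_of_step {E : Type*} [SeminormedAddCommGroup E] {x : ℕ → E} {L T : ℝ}
    (hτ : 0 ≤ τ) (hx : ∀ k : ℕ, k * τ ≤ T → ‖x (k + 1) - x k‖ ≤ L * τ) {i k : ℕ} (hik : i ≤ k)
    (hk : k * τ ≤ T) : ‖x k - x i‖ ≤ L * (k * τ - i * τ) := by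
  induction k, hik using Nat.le_induction with
  | base => simp
  | succ k _ ih =>
    have hkT : k * τ ≤ T := le_trans (by push_cast; linarith) hk
    have h1 := norm_sub_le_norm_sub_add_norm_sub (x (k + 1)) (x k) (x i)
    have h2 := hx k hkT
    have h3 := ih hkT
    push_cast
    linarith

theorem norm_euler_succ_fst_sub_le (hX : Xbar ∈ Kcone) (hτ : 0 ≤ τ) (k : ℕ) :
    ‖(euler F Xbar Vbar τ (k + 1)).1 - (euler F Xbar Vbar τ k).1‖ ≤
      ‖(euler F Xbar Vbar τ k).2‖ * τ := by
  have h := norm_projK_sub_le ((euler F Xbar Vbar τ k).1 + τ • (euler F Xbar Vbar τ k).2)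
    (euler F Xbar Vbar τ k).1
  rwa [projK_eq_self (euler_mem hX k), add_sub_cancel_left, norm_smul,
    Real.norm_of_nonneg hτ, mul_comm τ, ← euler_succ_fst] at h

theorem norm_euler_succ_snd_sub_le (hτ : 0 ≤ τ) (k : ℕ) :
    ‖(euler F Xbar Vbar τ (k + 1)).2 - (euler F Xbar Vbar τ k).2‖ ≤
      ‖F (euler F Xbar Vbar τ k).1‖ * τ := by
  rw [euler_succ_snd, add_sub_cancel_left, norm_smul, Real.norm_of_nonneg hτ, mul_comm]

/-- The discrete evolution variational inequality satisfied by the Euler scheme. -/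
theorem euler_variational_ineq (hX : Xbar ∈ Kcone) (hτ : 0 ≤ τ) {T L : ℝ}
    (hL : ∀ k : ℕ, k * τ ≤ T → ‖(euler F Xbar Vbar τ k).1‖ ≤ L ∧
      ‖(euler F Xbar Vbar τ k).2‖ ≤ L ∧ ‖F (euler F Xbar Vbar τ k).1‖ ≤ L)
    {Z : L2} (hZ : Z ∈ Kcone) {i k : ℕ} (hik : i ≤ k) (hk : k * τ ≤ T) :
    ‖(euler F Xbar Vbar τ k).1 - Z‖ ^ 2 / 2 - ‖(euler F Xbar Vbar τ i).1 - Z‖ ^ 2 / 2 ≤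
      (k * τ - i * τ) * ⟪(euler F Xbar Vbar τ i).2, (euler F Xbar Vbar τ i).1 - Z⟫ +
        L * (2 * L + ‖Z‖) * (k * τ - i * τ) ^ 2 := by
  induction k, hik using Nat.le_induction with
  | base => simp
  | succ k hik ih =>
    have hkT : k * τ ≤ T := le_trans (by push_cast; linarith) hk
    have h0 := ih hkT
    have hL0 : 0 ≤ L := (norm_nonneg _).trans (hL k hkT).1
    have hstep1 : ∀ j : ℕ, j * τ ≤ T →
        ‖(euler F Xbar Vbar τ (j + 1)).1 - (euler F Xbar Vbar τ j).1‖ ≤ L * τ := fun j hj =>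
      (norm_euler_succ_fst_sub_le hX hτ j).trans (mul_le_mul_of_nonneg_right (hL j hj).2.1 hτ)
    have hstep2 : ∀ j : ℕ, j * τ ≤ T →
        ‖(euler F Xbar Vbar τ (j + 1)).2 - (euler F Xbar Vbar τ j).2‖ ≤ L * τ := fun j hj =>
      (norm_euler_succ_snd_sub_le hτ j).trans (mul_le_mul_of_nonneg_right (hL j hj).2.2 hτ)
    have hdx := norm_sub_le_of_step (x := fun j => (euler F Xbar Vbar τ j).1) hτ hstep1
      (hik.trans (Nat.le_succ k)) hk
    have hdy := norm_sub_le_of_step (x := fun j => (euler F Xbar Vbar τ j).2) hτ hstep2 hik hkT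
    have hproj := inner_projK_le
      ((euler F Xbar Vbar τ k).1 + τ • (euler F Xbar Vbar τ k).2) hZ
    rw [← euler_succ_fst] at hproj
    have hx'L := (hL (k + 1) hk).1
    have hyL := (hL i (le_trans (by gcongr) hkT)).2.1
    have hd0 : (i : ℝ) * τ ≤ k * τ := by gcongr
    set x := (euler F Xbar Vbar τ k).1
    set y := (euler F Xbar Vbar τ k).2
    set x' := (euler F Xbar Vbar τ (k + 1)).1
    set xi := (euler F Xbar Vbar τ i).1
    set yi := (euler F Xbar Vbar τ i).2
    have hsq : ‖x' - Z‖ ^ 2 / 2 - ‖x - Z‖ ^ 2 / 2 ≤ ⟪x' - x, x' - Z⟫ := by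
      have h1 := norm_sub_sq_real (x' - Z) (x' - x)
      rw [sub_sub_sub_cancel_left, real_inner_comm] at h1
      nlinarith [sq_nonneg ‖x' - x‖]
    have hpr : ⟪x' - x, x' - Z⟫ ≤ τ * ⟪y, x' - Z⟫ := by
      have h1 : ⟪x + τ • y - x', Z - x'⟫ = ⟪x' - x, x' - Z⟫ - τ * ⟪y, x' - Z⟫ := by
        rw [← real_inner_smul_left, ← inner_sub_left, ← neg_sub x' Z, inner_neg_right,
          ← inner_neg_left]
        congr 1
        abel
      linarith
    have hdiff : ⟪y, x' - Z⟫ ≤ ⟪yi, xi - Z⟫ +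
        L * (2 * L + ‖Z‖) * (k * τ - i * τ + τ) := by
      have h1 : ⟪y, x' - Z⟫ = ⟪yi, xi - Z⟫ + ⟪y - yi, x' - Z⟫ + ⟪yi, x' - xi⟫ := by
        simp only [inner_sub_left, inner_sub_right]; ring
      have h2 : ⟪y - yi, x' - Z⟫ ≤ L * (k * τ - i * τ) * (L + ‖Z‖) := by
        refine (real_inner_le_norm _ _).trans ?_
        have h3 := (norm_sub_le x' Z).trans (by gcongr : ‖x'‖ + ‖Z‖ ≤ L + ‖Z‖)
        exact mul_le_mul hdy h3 (norm_nonneg _) ((norm_nonneg _).trans hdy)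
      have h3 : ⟪yi, x' - xi⟫ ≤ L * (L * ((k + 1 : ℕ) * τ - i * τ)) :=
        (real_inner_le_norm _ _).trans (mul_le_mul hyL hdx (norm_nonneg _) hL0)
      push_cast at h3
      have h4 : 0 ≤ L * (L + ‖Z‖) * τ := by positivity
      nlinarith
    have hdiff' := mul_le_mul_of_nonneg_left hdiff hτ
    have hE : 0 ≤ L * (2 * L + ‖Z‖) := by positivity
    push_cast
    have h5 : 0 ≤ L * (2 * L + ‖Z‖) * (τ * (k * τ - i * τ)) :=
      mul_nonneg hE (mul_nonneg hτ (by linarith))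
    nlinarith

end euler

theorem floor_div_mul_le {t τ : ℝ} (ht : 0 ≤ t) (hτ : 0 < τ) : ⌊t / τ⌋₊ * τ ≤ t := by
  rw [← le_div_iff₀ hτ]
  exact Nat.floor_le (by positivity)

theorem lt_floor_div_mul_add {t τ : ℝ} (hτ : 0 < τ) : t < ⌊t / τ⌋₊ * τ + τ := by
  have h := Nat.lt_floor_add_one (t / τ)
  rw [div_lt_iff₀ hτ] at h
  linarith

theorem tendsto_floor_div_mul {ι : Type*} {l : Filter ι} {τ : ι → ℝ} (hτ : ∀ n, 0 < τ n)
    (hlim : Tendsto τ l (𝓝 0)) {t : ℝ} (ht : 0 ≤ t) :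
    Tendsto (fun n => (⌊t / τ n⌋₊ : ℝ) * τ n) l (𝓝 t) := by
  refine tendsto_of_tendsto_of_tendsto_of_le_of_le (g := fun n => t - τ n) (h := fun _ => t)
    (by simpa using hlim.const_sub t) tendsto_const_nhds (fun n => ?_)
    fun n => floor_div_mul_le ht (hτ n)
  have := lt_floor_div_mul_add (t := t) (hτ n)
  simp only
  linarith

theorem UnifCont.exists_delta {F : L2 → L2} (hF : UnifCont F) {ε : ℝ} (hε : 0 < ε) :
    ∃ δ > 0, ∀ X ∈ Kcone, ∀ Z ∈ Kcone, ‖X - Z‖ ≤ δ → ‖F X - F Z‖ ≤ ε := by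
  obtain ⟨-, ω, hωc, -, -, hω0, -, hω⟩ := hF
  have h1 := Metric.continuousWithinAt_iff.mp (hωc 0 self_mem_Ici) ε hε
  obtain ⟨δ, hδ, h2⟩ := h1
  refine ⟨δ / 2, by positivity, fun X hX Z hZ h => (hω X hX Z hZ).trans ?_⟩
  have h3 := h2 (norm_nonneg (X - Z)) (by
    rw [dist_zero_right, norm_norm]; linarith)
  rw [hω0, dist_zero_right] at h3
  exact (le_abs_self _).trans h3.le

/-- Comparison of an explicit Euler quadrature with an integral. -/
theorem norm_euler_sub_integral_le {E : Type*} [NormedAddCommGroup E] [NormedSpace ℝ E]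
    [CompleteSpace E] {f : ℝ → E} (hf : Continuous f) {y g : ℕ → E} {τ T ε : ℝ} (hτ : 0 ≤ τ)
    (hy : ∀ k, y (k + 1) = y k + τ • g k)
    (hg : ∀ k : ℕ, (k + 1 : ℕ) * τ ≤ T → ∀ s ∈ Icc (k * τ) ((k + 1 : ℕ) * τ), ‖g k - f s‖ ≤ ε)
    (k : ℕ) (hk : k * τ ≤ T) : ‖y k - (y 0 + ∫ s in (0 : ℝ)..k * τ, f s)‖ ≤ ε * (k * τ) := by
  induction k with
  | zero => simp
  | succ k ih =>
    have hkT : k * τ ≤ T := le_trans (by push_cast; linarith) hk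
    have hle : k * τ ≤ (k + 1 : ℕ) * τ := by push_cast; linarith
    have hlen : ((k + 1 : ℕ) * τ - k * τ) = τ := by push_cast; ring
    have h1 := intervalIntegral.norm_integral_le_of_norm_le_const (f := fun s => g k - f s)
      (a := k * τ) (b := (k + 1 : ℕ) * τ) (C := ε) fun s hs => by
        rw [uIoc_of_le hle] at hs
        exact hg k hk s (Ioc_subset_Icc_self hs)
    rw [intervalIntegral.integral_sub intervalIntegrable_const (hf.intervalIntegrable _ _),
      intervalIntegral.integral_const, hlen, abs_of_nonneg hτ] at h1
    rw [hy, ← intervalIntegral.integral_add_adjacent_intervals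
      (hf.intervalIntegrable 0 (k * τ)) (hf.intervalIntegrable _ _)]
    rw [show y k + τ • g k - (y 0 + ((∫ s in (0 : ℝ)..k * τ, f s) +
      ∫ s in (k * τ)..(k + 1 : ℕ) * τ, f s)) = (y k - (y 0 + ∫ s in (0 : ℝ)..k * τ, f s)) +
      (τ • g k - ∫ s in (k * τ)..(k + 1 : ℕ) * τ, f s) by abel]
    refine (norm_add_le _ _).trans ?_
    have h2 := ih hkT
    push_cast at h1 ⊢
    linarith

/-- A limit point of the Euler schemes along a filter of vanishing time steps. -/
structure EulerLimit (F : L2 → L2) (Xbar Vbar : L2) (l : Filter ℕ) (τ : ℕ → ℝ) (X : ℝ → L2) :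
    Prop where
  mem_bar : Xbar ∈ Kcone
  pos : ∀ n, 0 < τ n
  tendsto_zero : Tendsto τ l (𝓝 0)
  mem : ∀ t, 0 ≤ t → X t ∈ Kcone
  tendsto : ∀ t, 0 ≤ t →
    Tendsto (fun n => (euler F Xbar Vbar (τ n) ⌊t / τ n⌋₊).1) l (𝓝 (X t))

theorem exists_eulerLimit {F : L2 → L2} {Cp : ℝ} (hptw : PtwLinBdd F Cp) (hF : UnifCont F)
    {Xbar : L2} (hX : Xbar ∈ Kcone) (Vbar : L2) :
    ∃ (l : Filter ℕ) (τ : ℕ → ℝ) (X : ℝ → L2), l.NeBot ∧ EulerLimit F Xbar Vbar l τ X := by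
  have hpos : ∀ n : ℕ, (0 : ℝ) < 1 / ((n : ℝ) + 1) := fun n => Nat.one_div_pos_of_nat
  have h : ∀ t : ℝ, ∃ Z : L2, 0 ≤ t → Z ∈ Kcone ∧
      Tendsto (fun n : ℕ => (euler F Xbar Vbar (1 / ((n : ℝ) + 1)) ⌊t / (1 / ((n : ℝ) + 1))⌋₊).1)
        (hyperfilter ℕ) (𝓝 Z) := by
    intro t
    by_cases ht : 0 ≤ t
    · obtain ⟨Q, hQ, hQK, hmem⟩ := exists_compact_euler hptw hF hX Vbar t
      obtain ⟨Z, hZ, hlim⟩ := hQ.ultrafilter_le_nhds ((hyperfilter ℕ).map fun n : ℕ =>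
        (euler F Xbar Vbar (1 / ((n : ℝ) + 1)) ⌊t / (1 / ((n : ℝ) + 1))⌋₊).1)
        (le_principal_iff.mpr (Ultrafilter.mem_map.mpr (univ_mem' fun n =>
          hmem _ (hpos n).le _ (floor_div_mul_le ht (hpos n)))))
      exact ⟨Z, fun _ => ⟨hQK hZ, hlim⟩⟩
    · exact ⟨0, fun h => absurd h ht⟩
  choose X hX' using h
  refine ⟨hyperfilter ℕ, fun n => 1 / ((n : ℝ) + 1), X, inferInstance, hX, hpos, ?_,
    fun t ht => (hX' t ht).1, fun t ht => (hX' t ht).2⟩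
  exact tendsto_one_div_add_atTop_nhds_zero_nat.mono_left
    ((hyperfilter_le_cofinite).trans_eq Nat.cofinite_eq_atTop)

namespace EulerLimit

variable {F : L2 → L2} {Xbar Vbar : L2} {l : Filter ℕ} {τ : ℕ → ℝ} {X : ℝ → L2}

theorem tendsto_floor (h : EulerLimit F Xbar Vbar l τ X) {t : ℝ} (ht : 0 ≤ t) :
    Tendsto (fun n => (⌊t / τ n⌋₊ : ℝ) * τ n) l (𝓝 t) :=
  tendsto_floor_div_mul h.pos h.tendsto_zero ht

theorem floor_mono (h : EulerLimit F Xbar Vbar l τ X) {s t : ℝ} (hst : s ≤ t) (n : ℕ) :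
    ⌊s / τ n⌋₊ ≤ ⌊t / τ n⌋₊ :=
  Nat.floor_le_floor (div_le_div_of_nonneg_right hst (h.pos n).le)

variable [l.NeBot]

theorem zero_eq (h : EulerLimit F Xbar Vbar l τ X) : X 0 = Xbar := by
  have h1 := h.tendsto 0 le_rfl
  simp only [zero_div, Nat.floor_zero] at h1
  exact tendsto_nhds_unique h1 tendsto_const_nhds

theorem norm_sub_le (h : EulerLimit F Xbar Vbar l τ X) {T L : ℝ}
    (hL : ∀ τ : ℝ, 0 ≤ τ → ∀ k : ℕ, k * τ ≤ T → ‖(euler F Xbar Vbar τ k).2‖ ≤ L)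
    {s t : ℝ} (hs : 0 ≤ s) (hst : s ≤ t) (ht : t ≤ T) : ‖X t - X s‖ ≤ L * (t - s) := by
  refine le_of_tendsto_of_tendsto' ((h.tendsto t (hs.trans hst)).sub (h.tendsto s hs)).norm
    (((h.tendsto_floor (hs.trans hst)).sub (h.tendsto_floor hs)).const_mul L) fun n => ?_
  have hτ := (h.pos n).le
  exact norm_sub_le_of_step (x := fun k => (euler F Xbar Vbar (τ n) k).1) hτ
    (fun k hk => (norm_euler_succ_fst_sub_le h.mem_bar hτ k).trans
      (mul_le_mul_of_nonneg_right (hL _ hτ k hk) hτ)) (h.floor_mono hst n)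
    ((floor_div_mul_le (hs.trans hst) (h.pos n)).trans ht)

theorem lipschitzOnWith (h : EulerLimit F Xbar Vbar l τ X) {T : ℝ} {L : ℝ≥0}
    (hL : ∀ τ : ℝ, 0 ≤ τ → ∀ k : ℕ, k * τ ≤ T → ‖(euler F Xbar Vbar τ k).2‖ ≤ L) :
    LipschitzOnWith L X (Icc 0 T) := by
  refine LipschitzOnWith.of_dist_le_mul fun s hs t ht => ?_
  rw [dist_eq_norm, Real.dist_eq]
  rcases le_total s t with hst | hst
  · rw [norm_sub_rev, abs_sub_comm, abs_of_nonneg (by linarith)]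
    exact h.norm_sub_le hL hs.1 hst ht.2
  · rw [abs_of_nonneg (by linarith)]
    exact h.norm_sub_le hL ht.1 hst hs.2

/-- The Euler schemes converge uniformly on bounded time intervals. -/
theorem eventually_norm_sub_le (h : EulerLimit F Xbar Vbar l τ X) {T : ℝ} {L : ℝ≥0}
    (hL : ∀ τ : ℝ, 0 ≤ τ → ∀ k : ℕ, k * τ ≤ T → ‖(euler F Xbar Vbar τ k).2‖ ≤ L) {δ : ℝ}
    (hδ : 0 < δ) : ∀ᶠ n in l, ∀ k : ℕ, (k + 1 : ℕ) * τ n ≤ T →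
      ∀ s ∈ Icc (k * τ n) ((k + 1 : ℕ) * τ n), ‖(euler F Xbar Vbar (τ n) k).1 - X s‖ ≤ δ := by
  have hL0 := L.coe_nonneg
  obtain ⟨η, hη, hηδ⟩ : ∃ η : ℝ, 0 < η ∧ 5 * L * η ≤ δ / 2 := by
    refine ⟨δ / (10 * (L + 1)), by positivity, ?_⟩
    rw [mul_div_assoc', div_le_iff₀ (by positivity)]
    nlinarith
  have hgrid : ∀ᶠ n in l, ∀ j ∈ Finset.range (⌊T / η⌋₊ + 1),
      ‖(euler F Xbar Vbar (τ n) ⌊j * η / τ n⌋₊).1 - X (j * η)‖ < δ / 2 := by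
    rw [eventually_all_finset]
    intro j _
    have h1 := tendsto_iff_norm_sub_tendsto_zero.mp (h.tendsto (j * η) (by positivity))
    exact h1.eventually (gt_mem_nhds (by positivity))
  filter_upwards [hgrid, h.tendsto_zero.eventually (gt_mem_nhds hη)] with n hn hτη k hk s hs
  have hτ := h.pos n
  have hs0 : 0 ≤ s := le_trans (by positivity) hs.1
  have hsT : s ≤ T := hs.2.trans hk
  set j := ⌊s / η⌋₊ with hj
  have hjs : j * η ≤ s := floor_div_mul_le hs0 hη
  have hjs' : s < j * η + η := lt_floor_div_mul_add hη
  have hjN : j ∈ Finset.range (⌊T / η⌋₊ + 1) :=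
    Finset.mem_range.mpr (Nat.lt_succ_of_le (Nat.floor_le_floor (by gcongr)))
  have h1 := hn j hjN
  set i := ⌊j * η / τ n⌋₊ with hi
  have hij : i * τ n ≤ j * η := floor_div_mul_le (by positivity) hτ
  have hij' : j * η < i * τ n + τ n := lt_floor_div_mul_add hτ
  have hik : i ≤ k + 1 := by
    have : (i : ℝ) * τ n ≤ (k + 1 : ℕ) * τ n := hij.trans (hjs.trans hs.2)
    exact_mod_cast le_of_mul_le_mul_right this hτ
  have hstep : ∀ m : ℕ, m * τ n ≤ T →
      ‖(euler F Xbar Vbar (τ n) (m + 1)).1 - (euler F Xbar Vbar (τ n) m).1‖ ≤ L * τ n :=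
    fun m hm => (norm_euler_succ_fst_sub_le h.mem_bar hτ.le m).trans
      (mul_le_mul_of_nonneg_right (hL _ hτ.le m hm) hτ.le)
  have h2 := norm_sub_le_of_step (x := fun m => (euler F Xbar Vbar (τ n) m).1) hτ.le hstep hik hk
  have h3 := hstep k (hs.1.trans hsT)
  have h4 := h.norm_sub_le hL (by positivity) hjs hsT
  have h5 : (k + 1 : ℕ) * τ n = k * τ n + τ n := by push_cast; ring
  have h6 : (L : ℝ) * ((k + 1 : ℕ) * τ n - i * τ n) ≤ L * (3 * η) :=
    mul_le_mul_of_nonneg_left (by rw [h5]; linarith [hs.1]) hL0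
  have h7 : (L : ℝ) * τ n ≤ L * η := mul_le_mul_of_nonneg_left hτη.le hL0
  have h8 : (L : ℝ) * (s - j * η) ≤ L * η := mul_le_mul_of_nonneg_left (by linarith) hL0
  set x := (euler F Xbar Vbar (τ n) k).1
  set x' := (euler F Xbar Vbar (τ n) (k + 1)).1
  set xi := (euler F Xbar Vbar (τ n) i).1
  have h9 := norm_sub_le_norm_sub_add_norm_sub x x' (X s)
  have h10 := norm_sub_le_norm_sub_add_norm_sub x' xi (X s)
  have h11 := norm_sub_le_norm_sub_add_norm_sub xi (X (j * η)) (X s)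
  rw [norm_sub_rev x x'] at h9
  rw [norm_sub_rev (X (j * η)) (X s)] at h11
  linarith

theorem continuous_force (h : EulerLimit F Xbar Vbar l τ X) (hF : UnifCont F) :
    Continuous fun t => F (X (max 0 t)) := by
  refine hF.continuousOn.comp_continuous ?_ fun t => h.mem _ (le_max_left 0 t)
  refine ContinuousOn.comp_continuous (s := Ici 0) (fun t ht => ?_) (by fun_prop)
    fun t => le_max_left 0 t
  obtain ⟨L, hL⟩ := exists_euler_bound hF h.mem_bar Vbar (t + 1)
  have hlip := h.lipschitzOnWith fun τ hτ k hk => (hL τ hτ k hk).2.1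
  refine (hlip.continuousOn t ⟨ht, by linarith⟩).mono_of_mem_nhdsWithin ?_
  have := inter_mem_nhdsWithin (Ici (0 : ℝ)) (Iic_mem_nhds (lt_add_one t))
  simpa [Ici_inter_Iic] using this

theorem tendsto_snd (h : EulerLimit F Xbar Vbar l τ X) (hF : UnifCont F) {t : ℝ} (ht : 0 ≤ t) :
    Tendsto (fun n => (euler F Xbar Vbar (τ n) ⌊t / τ n⌋₊).2) l
      (𝓝 (Vbar + ∫ s in Ioc (0 : ℝ) t, F (X s))) := by
  rw [← intervalIntegral_force_eq X ht]
  have hcont := h.continuous_force hF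
  obtain ⟨L, hL⟩ := exists_euler_bound hF h.mem_bar Vbar t
  have hprim : Continuous fun r => Vbar + ∫ s in (0 : ℝ)..r, F (X (max 0 s)) :=
    continuous_const.add (intervalIntegral.continuous_primitive
      (fun a b => hcont.intervalIntegrable a b) 0)
  have h1 := (hprim.tendsto t).comp (h.tendsto_floor ht)
  rw [Metric.tendsto_nhds]
  intro ε hε
  obtain ⟨δ, hδ, hFδ⟩ := hF.exists_delta (show 0 < ε / (2 * (t + 1)) by positivity)
  filter_upwards [h.eventually_norm_sub_le (fun τ hτ k hk => (hL τ hτ k hk).2.1) hδ,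
    Metric.tendsto_nhds.mp h1 (ε / 2) (by positivity)] with n hn hn'
  have hfl := floor_div_mul_le ht (h.pos n)
  have h2 := norm_euler_sub_integral_le hcont (y := fun k => (euler F Xbar Vbar (τ n) k).2)
    (g := fun k => F (euler F Xbar Vbar (τ n) k).1) (h.pos n).le (fun k => euler_succ_snd k)
    (T := t) (ε := ε / (2 * (t + 1))) (fun k hk s hs => by
      have hs0 : 0 ≤ s := le_trans (mul_nonneg k.cast_nonneg (h.pos n).le) hs.1
      rw [max_eq_right hs0]
      exact hFδ _ (euler_mem h.mem_bar k) _ (h.mem s hs0) (hn k hk s hs)) _ hfl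
  have h3 : ε / (2 * (t + 1)) * (⌊t / τ n⌋₊ * τ n) ≤ ε / 2 := by
    refine (mul_le_mul_of_nonneg_left hfl (by positivity)).trans ?_
    rw [div_mul_eq_mul_div, div_le_iff₀ (by positivity)]
    nlinarith
  rw [← dist_eq_norm] at h2
  refine (dist_triangle _ _ _).trans_lt ((add_lt_add_of_le_of_lt (h2.trans h3) hn').trans_eq ?_)
  ring

/-- The evolution variational inequality satisfied by limits of the Euler scheme. -/
theorem variational_ineq (h : EulerLimit F Xbar Vbar l τ X) (hF : UnifCont F) {T : ℝ} {L : ℝ≥0}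
    (hL : ∀ τ : ℝ, 0 ≤ τ → ∀ k : ℕ, k * τ ≤ T → ‖(euler F Xbar Vbar τ k).1‖ ≤ L ∧
      ‖(euler F Xbar Vbar τ k).2‖ ≤ L ∧ ‖F (euler F Xbar Vbar τ k).1‖ ≤ L)
    {Z : L2} (hZ : Z ∈ Kcone) {s t : ℝ} (hs : 0 ≤ s) (hst : s ≤ t) (ht : t ≤ T) :
    ‖X t - Z‖ ^ 2 / 2 - ‖X s - Z‖ ^ 2 / 2 ≤
      (t - s) * ⟪Vbar + ∫ r in Ioc (0 : ℝ) s, F (X r), X s - Z⟫ +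
        L * (2 * L + ‖Z‖) * (t - s) ^ 2 := by
  have h0t := hs.trans hst
  have hxt := h.tendsto t h0t
  have hxs := h.tendsto s hs
  have hd := (h.tendsto_floor h0t).sub (h.tendsto_floor hs)
  refine le_of_tendsto_of_tendsto'
    ((((hxt.sub_const Z).norm.pow 2).div_const 2).sub (((hxs.sub_const Z).norm.pow 2).div_const 2))
    ((hd.mul ((h.tendsto_snd hF hs).inner (hxs.sub_const Z))).add
      ((hd.pow 2).const_mul (L * (2 * L + ‖Z‖)))) fun n => ?_
  exact euler_variational_ineq h.mem_bar (h.pos n).le (hL _ (h.pos n).le) hZ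
    (h.floor_mono hst n) ((floor_div_mul_le h0t (h.pos n)).trans ht)

theorem sub_deriv_mem_normalCone (h : EulerLimit F Xbar Vbar l τ X) (hF : UnifCont F) {t : ℝ}
    (ht : 0 ≤ t) {V : L2} (hV : HasDerivAt X V t) :
    (Vbar + ∫ r in Ioc (0 : ℝ) t, F (X r)) - V ∈ normalCone (X t) := by
  intro Z hZ
  obtain ⟨L, hL⟩ := exists_euler_bound hF h.mem_bar Vbar (t + 1)
  set Y := Vbar + ∫ r in Ioc (0 : ℝ) t, F (X r)
  have hderiv : HasDerivAt (fun s => ‖X s - Z‖ ^ 2 / 2) ⟪V, X t - Z⟫ t := by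
    have h1 := (hV.sub_const Z).norm_sq.div_const 2
    rw [real_inner_comm] at h1
    simpa using h1
  have hright : Tendsto (fun r : ℝ => ⟪Y, X t - Z⟫ + L * (2 * L + ‖Z‖) * r) (𝓝[>] 0)
      (𝓝 (⟪Y, X t - Z⟫ + L * (2 * L + ‖Z‖) * 0)) :=
    ((continuous_const.add (continuous_const.mul continuous_id)).tendsto 0).mono_left
      nhdsWithin_le_nhds
  have hle : ⟪V, X t - Z⟫ ≤ ⟪Y, X t - Z⟫ + L * (2 * L + ‖Z‖) * 0 := by
    refine le_of_tendsto_of_tendsto hderiv.tendsto_slope_zero_right hright ?_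
    filter_upwards [Ioo_mem_nhdsGT (zero_lt_one' ℝ)] with r hr
    have h1 := h.variational_ineq hF hL hZ ht (by linarith [hr.1] : t ≤ t + r)
      (by linarith [hr.2])
    rw [smul_eq_mul, inv_mul_le_iff₀ hr.1]
    rw [add_sub_cancel_left] at h1
    linarith
  rw [← neg_sub (X t) Z, inner_neg_right, inner_sub_left]
  linarith

end EulerLimit

theorem exists_lagSol {F : L2 → L2} {Cp : ℝ} (hptw : PtwLinBdd F Cp) (hF : UnifCont F)
    {Xbar : L2} (hX : Xbar ∈ Kcone) (Vbar : L2) : ∃ X : ℝ → L2, LagSol F Xbar Vbar X := by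
  obtain ⟨l, τ, X, _, h⟩ := exists_eulerLimit hptw hF hX Vbar
  have hlip : ∀ T : ℝ, ∃ L : ℝ≥0, LipschitzOnWith L X (Icc 0 T) := fun T => by
    obtain ⟨L, hL⟩ := exists_euler_bound hF hX Vbar T
    exact ⟨L, h.lipschitzOnWith fun τ hτ k hk => (hL τ hτ k hk).2.1⟩
  refine ⟨X, h.mem, h.zero_eq, hlip, ?_⟩
  have : Fact ((2 : ℝ≥0∞) ≠ ∞) := ⟨ENNReal.ofNat_ne_top⟩
  have : IsSeparable mu := by unfold mu; infer_instance
  filter_upwards [ae_differentiableAt_of_lipschitzOnWith_Icc hlip,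
    ae_restrict_mem measurableSet_Ioi] with t ht ht0
  exact ⟨_, ht.hasDerivAt, h.sub_deriv_mem_normalCone hF (le_of_lt ht0) ht.hasDerivAt⟩

/-- If `F` is pointwise linearly bounded and uniformly continuous, then
for every `(X̄, V̄) ∈ K × L²(Ω)` there exists a Lagrangian solution; moreover for every
`T ≥ 0` there are constants `C_T` (and `C_{q,T}` for each admissible doubling integrand
`ψ`) bounding `‖X(t)‖ + ‖V(t)‖` by `C_T(1 + ‖X̄‖ + ‖V̄‖)` and `Ψ[X(t)] + Ψ[V(t)]` by
`C_{q,T}(1 + Ψ[X̄] + Ψ[V̄])` for a.e. `t ∈ [0,T]`. -/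
theorem stmt15 (F : L2 → L2) (Cp : ℝ) (hptw : PtwLinBdd F Cp) (hF : UnifCont F) :
    (∀ Xbar ∈ Kcone, ∀ Vbar : L2, ∃ X : ℝ → L2, LagSol F Xbar Vbar X) ∧
    (∀ T : ℝ, 0 ≤ T → ∃ CT : ℝ, 0 ≤ CT ∧
      ∀ Xbar ∈ Kcone, ∀ Vbar : L2, ∀ X : ℝ → L2, LagSol F Xbar Vbar X →
        ∀ᵐ t ∂(volume.restrict (Set.Icc (0:ℝ) T)),
          ∀ V : L2, HasDerivAt X V t →
            ‖X t‖ + ‖V‖ ≤ CT * (1 + ‖Xbar‖ + ‖Vbar‖)) ∧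
    (∀ ψ : ℝ → ℝ, ∀ q : ℝ, AdmissibleDoubling ψ q →
      ∀ T : ℝ, 0 ≤ T → ∃ CqT : ℝ, 0 ≤ CqT ∧
        ∀ Xbar ∈ Kcone, ∀ Vbar : L2, ∀ X : ℝ → L2, LagSol F Xbar Vbar X →
          ∀ᵐ t ∂(volume.restrict (Set.Icc (0:ℝ) T)),
            ∀ V : L2, HasDerivAt X V t →
              PsiL ψ (X t) + PsiL ψ V ≤
                ENNReal.ofReal CqT * (1 + PsiL ψ Xbar + PsiL ψ Vbar)) := by
  refine ⟨fun Xbar hX Vbar => exists_lagSol hptw hF hX Vbar, fun T hT => ?_,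
    fun ψ q hψ T hT => ?_⟩
  · obtain ⟨C, hC, h⟩ := LagSol.norm_bound hF hT
    exact ⟨C, hC, fun Xbar _ Vbar X hX => h Xbar Vbar X hX⟩
  · obtain ⟨C, hC, h⟩ := LagSol.psi_bound hptw hF hψ hT
    exact ⟨C, hC, fun Xbar _ Vbar X hX => h Xbar Vbar X hX⟩
end
end

section
/- Let (X_n) ⊂ K and (Z_n), (F_n) ⊂ L²(Ω) be sequences with Z_n − F_n ∈ H_{X_n}^⊥ for all n. Suppose X_n → X strongly in L²(Ω) with X ∈ K, and Z_n ⇀ Z and F_n ⇀ F weakly in L²(Ω). Then Z − F ∈ H_X^⊥. If in addition Z_n ≺ F_n for all n and F_n → F strongly in L¹(Ω), then Z ≺ F. -/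
open MeasureTheory Set Filter
open scoped ENNReal NNReal RealInnerProductSpace

noncomputable section

/-- `Ω_X`: points of `Ω` near which `X` is (essentially) constant. -/
def OmegaX (X : L2) : Set ℝ :=
  {m | m ∈ Omg ∧ ∃ U ∈ nhds m, ∃ c : ℝ, ∀ᵐ x ∂(mu.restrict U), X x = c}

/-- The closed subspace `H_X` of functions admitting a representative that is constant on
each connected component of `Ω_X`. -/
def HX (X : L2) : Set L2 :=
  {U | ∃ g : ℝ → ℝ, ⇑U =ᵐ[mu] g ∧
    ∀ m ∈ OmegaX X, ∀ m' ∈ connectedComponentIn (OmegaX X) m, g m' = g m}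

/-- The orthogonal complement `H_X^⊥`. -/
def HXperp (X : L2) : Set L2 := {W | ∀ U ∈ HX X, ⟪W, U⟫ = 0}

/-- `Z ≺ Y`: every convex lower semicontinuous integrand `φ : ℝ → [0,∞]` has
`∫ φ(Z) ≤ ∫ φ(Y)`. -/
def Dominated (Z Y : L2) : Prop :=
  ∀ φ : ℝ → ℝ≥0∞, LowerSemicontinuous φ →
    (∀ x y : ℝ, ∀ a b : ℝ≥0, a + b = 1 →
      φ ((a : ℝ) * x + (b : ℝ) * y) ≤ (a : ℝ≥0∞) * φ x + (b : ℝ≥0∞) * φ y) →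
    (∫⁻ m, φ (Z m) ∂mu) ≤ ∫⁻ m, φ (Y m) ∂mu

/-- Weak convergence in `L²(Ω)`. -/
def WeakConv (Z : ℕ → L2) (Zlim : L2) : Prop :=
  ∀ G : L2, Tendsto (fun n => (⟪Z n, G⟫ : ℝ)) atTop (nhds ⟪Zlim, G⟫)

instance : IsFiniteMeasure mu := by
  unfold mu Omg
  infer_instance

lemma inner_eq_integral (U W : L2) : (⟪U, W⟫ : ℝ) = ∫ m, U m * W m ∂mu := by
  rw [L2.inner_def]
  exact integral_congr_ae (Eventually.of_forall fun m => by simp [mul_comm])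

/-- Composition of an `L²` function with a Lipschitz function is in `L²`. -/
lemma memLp_lipschitz_comp {f : ℝ → ℝ} {c : ℝ≥0} (hf : LipschitzWith c f) (V : L2) :
    MemLp (fun x => f (V x)) 2 mu := by
  have h0 : LipschitzWith c (fun x => f x - f 0) := by
    simpa using hf.sub (LipschitzWith.const (f 0))
  have h1 := (h0.comp_memLp (by simp) (Lp.memLp V)).add (memLp_const (f 0))
  refine h1.ae_eq (Eventually.of_forall fun x => ?_)
  simp

/-- Superposition by a Lipschitz function, as a map of `L²`. -/
def lipComp {f : ℝ → ℝ} {c : ℝ≥0} (hf : LipschitzWith c f) (V : L2) : L2 :=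
  (memLp_lipschitz_comp hf V).toLp _

lemma coeFn_lipComp {f : ℝ → ℝ} {c : ℝ≥0} (hf : LipschitzWith c f) (V : L2) :
    lipComp hf V =ᵐ[mu] fun x => f (V x) :=
  MemLp.coeFn_toLp _

lemma lipschitzWith_lipComp {f : ℝ → ℝ} {c : ℝ≥0} (hf : LipschitzWith c f) :
    LipschitzWith c (lipComp hf) := by
  refine LipschitzWith.of_dist_le_mul fun V W => ?_
  rw [dist_eq_norm, dist_eq_norm]
  apply Lp.norm_le_mul_norm_of_ae_le_mul
  filter_upwards [coeFn_lipComp hf V, coeFn_lipComp hf W,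
    Lp.coeFn_sub (lipComp hf V) (lipComp hf W), Lp.coeFn_sub V W] with a h1 h2 h3 h4
  rw [h3, h4, Pi.sub_apply, Pi.sub_apply, h1, h2, ← dist_eq_norm, ← dist_eq_norm]
  exact hf.dist_le_mul _ _

/-- Weak–strong convergence of pairings. -/
lemma tendsto_inner_of_weak_strong {W G : ℕ → L2} {W' G' : L2} (hW : WeakConv W W')
    (hG : Tendsto G atTop (nhds G')) :
    Tendsto (fun n => (⟪W n, G n⟫ : ℝ)) atTop (nhds ⟪W', G'⟫) := by
  obtain ⟨C, hC⟩ := banach_steinhaus (g := fun n => innerSL ℝ (W n)) (fun x => by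
    obtain ⟨C, hC⟩ := ((hW x).norm).bddAbove_range
    exact ⟨C, fun i => hC ⟨i, rfl⟩⟩)
  have hC' : ∀ n, ‖W n‖ ≤ C := fun n => by simpa using hC n
  have h1 : Tendsto (fun n => (⟪W n, G n - G'⟫ : ℝ)) atTop (nhds 0) := by
    have h2 : Tendsto (fun n => C * ‖G n - G'‖) atTop (nhds 0) := by
      simpa using (tendsto_iff_norm_sub_tendsto_zero.1 hG).const_mul C
    refine squeeze_zero_norm (fun n => ?_) h2
    exact (norm_inner_le_norm _ _).trans
      (mul_le_mul_of_nonneg_right (hC' n) (norm_nonneg _))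
  have h3 := h1.add (hW G')
  rw [zero_add] at h3
  refine h3.congr fun n => ?_
  rw [inner_sub_right, sub_add_cancel]

/-- A monotone representative is locally constant on `Ω_X`. -/
lemma eventually_eq_of_mem_OmegaX {X : L2} {g : ℝ → ℝ} (hg : MonotoneOn g Omg)
    (hXg : ⇑X =ᵐ[mu] g) {m : ℝ} (hm : m ∈ OmegaX X) : ∀ᶠ x in nhds m, g m = g x := by
  obtain ⟨hmΩ, U, hU, c, hc⟩ := hm
  obtain ⟨ε, hε, hball⟩ := Metric.mem_nhds_iff.1 (inter_mem hU (isOpen_Ioo.mem_nhds hmΩ))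
  rw [Real.ball_eq_Ioo] at hball
  have hae : ∀ᵐ x ∂(volume : Measure ℝ), x ∈ Ioo (m - ε) (m + ε) → g x = c := by
    have h1 : ∀ᵐ x ∂(mu.restrict (Ioo (m - ε) (m + ε))), X x = c :=
      ae_restrict_of_ae_restrict_of_subset (fun x hx => (hball hx).1) hc
    rw [ae_restrict_iff' measurableSet_Ioo] at h1
    have h2 : ∀ᵐ x ∂mu, x ∈ Ioo (m - ε) (m + ε) → g x = c := by
      filter_upwards [h1, hXg] with x hx hx' hxI
      rw [← hx', hx hxI]
    unfold mu at h2
    rw [ae_restrict_iff' (by exact measurableSet_Ioo)] at h2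
    filter_upwards [h2] with x hx hxI
    exact hx (hball hxI).2 hxI
  have hdense := Measure.dense_of_ae hae
  have key : ∀ x ∈ Ioo (m - ε) (m + ε), g x = c := by
    intro x hx
    obtain ⟨y, hy, hy1, hy2⟩ := hdense.exists_between hx.1
    obtain ⟨z, hz, hz1, hz2⟩ := hdense.exists_between hx.2
    have hyI : y ∈ Ioo (m - ε) (m + ε) := ⟨hy1, hy2.trans hx.2⟩
    have hzI : z ∈ Ioo (m - ε) (m + ε) := ⟨hx.1.trans hz1, hz2⟩
    apply le_antisymm
    · rw [← hz hzI]
      exact hg (hball hx).2 (hball hzI).2 hz1.le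
    · rw [← hy hyI]
      exact hg (hball hyI).2 (hball hx).2 hy2.le
  filter_upwards [Ioo_mem_nhds (sub_lt_self m hε) (lt_add_of_pos_right m hε)] with x hx
  rw [key x hx, key m ⟨sub_lt_self m hε, lt_add_of_pos_right m hε⟩]

/-- Lipschitz functions of `X` belong to `H_X`. -/
lemma lipComp_mem_HX {X : L2} (hX : X ∈ Kcone) {f : ℝ → ℝ} {c : ℝ≥0} (hf : LipschitzWith c f) :
    lipComp hf X ∈ HX X := by
  obtain ⟨g, hg, hXg⟩ := hX
  refine ⟨fun x => f (g x), ?_, fun m hm m' hm' => ?_⟩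
  · filter_upwards [coeFn_lipComp hf X, hXg] with x h1 h2
    rw [h1, h2]
  · refine congrArg f ?_
    refine (isPreconnected_connectedComponentIn (x := m) (F := OmegaX X)).induction₂
      (fun x y => g x = g y) (fun x hx => ?_) (fun x y z _ _ _ h1 h2 => h1.trans h2)
      (fun x y _ _ h => h.symm) hm' (mem_connectedComponentIn hm)
    exact (eventually_eq_of_mem_OmegaX hg hXg
      (connectedComponentIn_subset _ _ hx)).filter_mono nhdsWithin_le_nhds

/-- Finite measures on `ℝ` are determined by integrals of bounded Lipschitz functions. -/
lemma measure_ext_of_lipschitz {μ ν : Measure ℝ} [IsFiniteMeasure μ] [IsFiniteMeasure ν]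
    (h : ∀ (f : ℝ → ℝ) (c : ℝ≥0), LipschitzWith c f → ∫ x, f x ∂μ = ∫ x, f x ∂ν) : μ = ν := by
  refine Measure.ext_of_Iic μ ν fun a => ?_
  have hpos : ∀ n : ℕ, (0 : ℝ) < 1 / ((n : ℝ) + 1) := fun n => by positivity
  have h1 := tendsto_lintegral_thickenedIndicator_of_isClosed μ (isClosed_Iic (a := a)) hpos
    tendsto_one_div_add_atTop_nhds_zero_nat
  have h2 := tendsto_lintegral_thickenedIndicator_of_isClosed ν (isClosed_Iic (a := a)) hpos
    tendsto_one_div_add_atTop_nhds_zero_nat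
  refine tendsto_nhds_unique h1 (h2.congr fun n => ?_)
  rw [lintegral_coe_eq_integral _ (integrable_thickenedIndicator _ (hpos n)),
    lintegral_coe_eq_integral _ (integrable_thickenedIndicator _ (hpos n))]
  have hL := lipschitzWith_thickenedIndicator (hpos n) (Iic a)
  exact congrArg ENNReal.ofReal (h _ _ (fun x y => hL x y)).symm

/-- If `W` is orthogonal to every Lipschitz function of `X`, it is orthogonal to every
Borel function of `X`. -/
lemma integral_mul_comp_eq_zero {W X : L2}
    (h : ∀ (f : ℝ → ℝ) (c : ℝ≥0), LipschitzWith c f → ∫ m, W m * f (X m) ∂mu = 0)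
    {k : ℝ → ℝ} (hk : Measurable k) (hintegrable : Integrable (fun m => W m * k (X m)) mu) :
    ∫ m, W m * k (X m) ∂mu = 0 := by
  have hWm : Measurable W := (Lp.stronglyMeasurable W).measurable
  have hXm : Measurable X := (Lp.stronglyMeasurable X).measurable
  have hWi : Integrable W mu := (Lp.memLp W).integrable (by norm_num)
  have hp : Measurable fun m => (W m).toNNReal := hWm.real_toNNReal
  have hn : Measurable fun m => (-W m).toNNReal := hWm.neg.real_toNNReal
  have fin1 : IsFiniteMeasure (mu.withDensity fun m => ((W m).toNNReal : ℝ≥0∞)) :=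
    isFiniteMeasure_withDensity_ofReal hWi.2
  have fin2 : IsFiniteMeasure (mu.withDensity fun m => ((-W m).toNNReal : ℝ≥0∞)) :=
    isFiniteMeasure_withDensity_ofReal hWi.neg.2
  have key : ∀ f : ℝ → ℝ, Measurable f → Integrable (fun m => W m * f (X m)) mu →
      ∫ m, W m * f (X m) ∂mu =
      ∫ x, f x ∂((mu.withDensity fun m => ((W m).toNNReal : ℝ≥0∞)).map X) -
      ∫ x, f x ∂((mu.withDensity fun m => ((-W m).toNNReal : ℝ≥0∞)).map X) := by
    intro f hf hfi
    rw [integral_map hXm.aemeasurable hf.aestronglyMeasurable,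
      integral_map hXm.aemeasurable hf.aestronglyMeasurable,
      integral_withDensity_eq_integral_smul hp, integral_withDensity_eq_integral_smul hn,
      ← integral_sub]
    · refine integral_congr_ae (Eventually.of_forall fun m => ?_)
      simp only [NNReal.smul_def, Real.coe_toNNReal', smul_eq_mul, ← sub_mul]
      congr 1
      rcases le_total 0 (W m) with h | h <;> simp [h]
    · refine hfi.mono (by fun_prop) (Eventually.of_forall fun m => ?_)
      simp only [NNReal.smul_def, Real.coe_toNNReal', smul_eq_mul, norm_mul]
      gcongr
      rcases le_total 0 (W m) with h | h <;> simp [h]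
    · refine hfi.mono (by fun_prop) (Eventually.of_forall fun m => ?_)
      simp only [NNReal.smul_def, Real.coe_toNNReal', smul_eq_mul, norm_mul]
      gcongr
      rcases le_total 0 (W m) with h | h <;> simp [h]
  have heq : (mu.withDensity fun m => ((W m).toNNReal : ℝ≥0∞)).map X =
      (mu.withDensity fun m => ((-W m).toNNReal : ℝ≥0∞)).map X := by
    refine measure_ext_of_lipschitz fun f c hf => ?_
    have := key f hf.continuous.measurable
      ((Lp.memLp W).integrable_mul (memLp_lipschitz_comp hf X))
    rw [h f c hf] at this
    exact (sub_eq_zero.1 this.symm)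
  rw [key k hk hintegrable, heq, sub_self]

lemma le_volume_real_of_Ioc_subset {A : Set ℝ} {x : ℝ} (hA : A ⊆ Omg) (hx : 0 < x)
    (h : Ioc 0 x ⊆ A) : x ≤ volume.real A := by
  have hfin : volume A ≠ ∞ := measure_ne_top_of_subset hA (by simp [Omg])
  have := measureReal_mono h hfin
  simpa [Real.volume_real_Ioc_of_le hx.le] using this

lemma volume_real_le_of_subset_Ioc {A : Set ℝ} {x : ℝ} (hx : 0 < x)
    (h : A ⊆ Ioc 0 x) : volume.real A ≤ x := by
  have := measureReal_mono h (by simp : volume (Ioc 0 x) ≠ ∞)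
  simpa [Real.volume_real_Ioc_of_le hx.le] using this

/-- Every element of `H_X` is a Borel function of `X`. -/
lemma exists_measurable_comp_of_mem_HX {X U : L2} (hX : X ∈ Kcone) (hU : U ∈ HX X) :
    ∃ k : ℝ → ℝ, Measurable k ∧ ⇑U =ᵐ[mu] fun m => k (X m) := by
  obtain ⟨g, hg, hXg⟩ := hX
  obtain ⟨u, hUu, hu⟩ := hU
  let lo : ℝ → ℝ := fun y => volume.real {x | x ∈ Omg ∧ g x < y}
  let hi : ℝ → ℝ := fun y => volume.real {x | x ∈ Omg ∧ g x ≤ y}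
  have hΩfin : volume Omg ≠ ∞ := by simp [Omg]
  have hlo : Monotone lo := fun y z hyz =>
    measureReal_mono (fun x hx => ⟨hx.1, hx.2.trans_le hyz⟩)
      (measure_ne_top_of_subset (fun x hx => hx.1) hΩfin)
  have hhi : Monotone hi := fun y z hyz =>
    measureReal_mono (fun x hx => ⟨hx.1, hx.2.trans hyz⟩)
      (measure_ne_top_of_subset (fun x hx => hx.1) hΩfin)
  have hhilo : ∀ y z, y < z → hi y ≤ lo z := fun y z hyz =>
    measureReal_mono (fun x hx => ⟨hx.1, hx.2.trans_lt hyz⟩)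
      (measure_ne_top_of_subset (fun x hx => hx.1) hΩfin)
  have hlo_le : ∀ m ∈ Omg, lo (g m) ≤ m := fun m hm =>
    volume_real_le_of_subset_Ioc hm.1 fun x hx =>
      ⟨hx.1.1, le_of_not_ge fun h => (hg hm hx.1 h).not_gt hx.2⟩
  have hle_hi : ∀ m ∈ Omg, m ≤ hi (g m) := fun m hm =>
    le_volume_real_of_Ioc_subset (fun x hx => hx.1) hm.1 fun x hx =>
      ⟨⟨hx.1, hx.2.trans_lt hm.2⟩, hg ⟨hx.1, hx.2.trans_lt hm.2⟩ hm hx.2⟩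
  have hlo0 : ∀ y, 0 ≤ lo y := fun y => measureReal_nonneg
  have hhi1 : ∀ y, hi y ≤ 1 := fun y => by
    have := measureReal_mono (μ := volume) (fun x hx => hx.1 : {x | x ∈ Omg ∧ g x ≤ y} ⊆ Omg) hΩfin
    exact this.trans (by simp [Omg])
  have hlevel : ∀ y, ∀ x ∈ Ioo (lo y) (hi y), x ∈ Omg ∧ g x = y := by
    intro y x hx
    have hxΩ : x ∈ Omg := ⟨(hlo0 y).trans_lt hx.1, hx.2.trans_le (hhi1 y)⟩
    refine ⟨hxΩ, le_antisymm ?_ ?_⟩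
    · by_contra! hc
      refine hx.2.not_ge (volume_real_le_of_subset_Ioc hxΩ.1 fun z hz => ⟨hz.1.1, ?_⟩)
      exact le_of_not_ge fun h => ((hg hxΩ hz.1 h).trans hz.2).not_gt hc
    · by_contra! hc
      refine hx.1.not_ge (le_volume_real_of_Ioc_subset (fun z hz => hz.1) hxΩ.1 fun z hz => ?_)
      have hzΩ : z ∈ Omg := ⟨hz.1, hz.2.trans_lt hxΩ.2⟩
      exact ⟨hzΩ, (hg hzΩ hxΩ hz.2).trans_lt hc⟩
  have hsubset : ∀ y, Ioo (lo y) (hi y) ⊆ OmegaX X := fun y x hx => by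
    refine ⟨(hlevel y x hx).1, _, Ioo_mem_nhds hx.1 hx.2, y, ?_⟩
    rw [ae_restrict_iff' measurableSet_Ioo]
    filter_upwards [hXg] with z hz hzI
    rw [hz, (hlevel y z hzI).2]
  let Y : Set ℝ := {y | lo y < hi y}
  have hYc : Y.Countable := by
    refine PairwiseDisjoint.countable_of_isOpen (s := fun y => Ioo (lo y) (hi y)) ?_
      (fun _ _ => isOpen_Ioo) (fun y hy => nonempty_Ioo.2 hy)
    intro y _ z _ hyz
    refine disjoint_left.2 fun x hx hx' => hyz ?_
    rw [← (hlevel y x hx).2, ← (hlevel z x hx').2]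
  let mid : ℝ → ℝ := fun y => (lo y + hi y) / 2
  have hmid : Measurable mid := ((hlo.measurable).add hhi.measurable).div_const 2
  let C : Set ℝ := mid '' Y
  have hCc : C.Countable := hYc.image _
  classical
  let v : ℝ → ℝ := fun x => if x ∈ C then u x else U x
  have hv : Measurable v :=
    (Lp.stronglyMeasurable U).measurable.measurable_of_countable_ne
      (hCc.mono fun x hx => by
        by_contra hxC
        exact hx (by simp [v, hxC]))
  refine ⟨fun y => v (mid y), hv.comp hmid, ?_⟩
  have hE : ∀ᵐ m ∂mu, m ∉ lo '' Y ∪ hi '' Y := by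
    have h0 : volume (lo '' Y ∪ hi '' Y) = 0 :=
      ((hYc.image lo).union (hYc.image hi)).measure_zero _
    exact ae_restrict_of_ae (measure_eq_zero_iff_ae_notMem.1 h0)
  have hΩ : ∀ᵐ m ∂mu, m ∈ Omg := ae_restrict_mem (by exact measurableSet_Ioo)
  filter_upwards [hE, hΩ, hXg, hUu] with m hmE hmΩ hmX hmU
  rw [hmX, hmU]
  have h1 := hlo_le m hmΩ
  have h2 := hle_hi m hmΩ
  by_cases hy : g m ∈ Y
  · have hlt1 : lo (g m) < m :=
      lt_of_le_of_ne h1 fun h => hmE (Or.inl ⟨g m, hy, h⟩)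
    have hlt2 : m < hi (g m) :=
      lt_of_le_of_ne h2 fun h => hmE (Or.inr ⟨g m, hy, h.symm⟩)
    have hmC : mid (g m) ∈ C := ⟨_, hy, rfl⟩
    have hmI : m ∈ Ioo (lo (g m)) (hi (g m)) := ⟨hlt1, hlt2⟩
    simp only [v, if_pos hmC]
    refine (hu m (hsubset _ hmI) _ ?_).symm
    refine isPreconnected_Ioo.subset_connectedComponentIn hmI (hsubset _) ?_
    constructor <;> simp only [mid] <;> linarith
  · have h3 : hi (g m) ≤ lo (g m) := not_lt.1 hy
    have h4 : mid (g m) = m := by simp only [mid]; linarith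
    simp only [v, h4]
    split_ifs
    · rfl
    · exact hmU.symm

/-- Closedness of the relation `Z - F ∈ H_X^⊥`. -/
lemma sub_mem_HXperp_of_tendsto {Xseq W : ℕ → L2} {X W' : L2} (hXK : ∀ n, Xseq n ∈ Kcone)
    (hperp : ∀ n, W n ∈ HXperp (Xseq n)) (hX : X ∈ Kcone)
    (hXconv : Tendsto Xseq atTop (nhds X)) (hW : WeakConv W W') : W' ∈ HXperp X := by
  intro U hU
  obtain ⟨k, hk, hUk⟩ := exists_measurable_comp_of_mem_HX hX hU
  have hae : (fun m => W' m * U m) =ᵐ[mu] fun m => W' m * k (X m) := by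
    filter_upwards [hUk] with m hm
    rw [hm]
  rw [inner_eq_integral, integral_congr_ae hae]
  refine integral_mul_comp_eq_zero (fun f c hf => ?_) hk
    (((Lp.memLp W').integrable_mul (Lp.memLp U)).congr hae)
  have hlim := tendsto_inner_of_weak_strong hW
    (((lipschitzWith_lipComp hf).continuous.tendsto X).comp hXconv)
  have hzero : (⟪W', lipComp hf X⟫ : ℝ) = 0 :=
    tendsto_nhds_unique hlim
      (tendsto_const_nhds.congr fun n => (hperp n _ (lipComp_mem_HX (hXK n) hf)).symm)
  rw [inner_eq_integral] at hzero
  rw [← hzero]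
  refine integral_congr_ae ?_
  filter_upwards [coeFn_lipComp hf X] with m hm
  rw [hm]

lemma continuous_integral_lipschitz_comp {f : ℝ → ℝ} {c : ℝ≥0} (hf : LipschitzWith c f) :
    Continuous fun V : L2 => ∫ m, f (V m) ∂mu := by
  have h : (fun V : L2 => ∫ m, f (V m) ∂mu) =
      fun V => (⟪lipComp hf V, (memLp_const (1 : ℝ)).toLp⟫ : ℝ) := by
    funext V
    rw [inner_eq_integral]
    refine integral_congr_ae ?_
    filter_upwards [coeFn_lipComp hf V, (memLp_const (p := 2) (μ := mu) (1 : ℝ)).coeFn_toLp]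
      with m h1 h2
    rw [h1, h2, mul_one]
  rw [h]
  exact (lipschitzWith_lipComp hf).continuous.inner continuous_const

lemma integrable_lipschitz_comp {f : ℝ → ℝ} {c : ℝ≥0} (hf : LipschitzWith c f) (V : L2) :
    Integrable (fun m => f (V m)) mu :=
  (memLp_lipschitz_comp hf V).integrable (by norm_num)

/-- Sublevel sets of convex Lipschitz integral functionals are weakly sequentially closed. -/
lemma integral_convex_comp_le_of_weakConv {ψ : ℝ → ℝ} {c : ℝ≥0} (hψ : LipschitzWith c ψ)
    (hconv : ConvexOn ℝ univ ψ) {Zseq : ℕ → L2} {Z : L2} (hZ : WeakConv Zseq Z) {r : ℝ}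
    (hr : ∀ᶠ n in atTop, ∫ m, ψ (Zseq n m) ∂mu ≤ r) : ∫ m, ψ (Z m) ∂mu ≤ r := by
  by_contra hnot
  let S : Set L2 := {V | ∫ m, ψ (V m) ∂mu ≤ r}
  have hclosed : IsClosed S :=
    isClosed_le (continuous_integral_lipschitz_comp hψ) continuous_const
  have hS : Convex ℝ S := by
    intro V hV W hW a b ha hb hab
    have hle : ∫ m, ψ ((a • V + b • W : L2) m) ∂mu ≤
        ∫ m, (a * ψ (V m) + b * ψ (W m)) ∂mu := by
      refine integral_mono_ae (integrable_lipschitz_comp hψ _)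
        (((integrable_lipschitz_comp hψ V).const_mul a).add
          ((integrable_lipschitz_comp hψ W).const_mul b)) ?_
      filter_upwards [Lp.coeFn_add (a • V) (b • W), Lp.coeFn_smul a V, Lp.coeFn_smul b W]
        with m h1 h2 h3
      rw [h1, Pi.add_apply, h2, h3]
      exact hconv.2 (mem_univ _) (mem_univ _) ha hb hab
    rw [integral_add ((integrable_lipschitz_comp hψ V).const_mul a)
      ((integrable_lipschitz_comp hψ W).const_mul b), integral_const_mul,
      integral_const_mul] at hle
    have hV' : ∫ m, ψ (V m) ∂mu ≤ r := hV
    have hW' : ∫ m, ψ (W m) ∂mu ≤ r := hW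
    calc _ ≤ _ := hle
      _ ≤ a * r + b * r := by gcongr
      _ = r := by rw [← add_mul, hab, one_mul]
  obtain ⟨f, u, hfS, hfZ⟩ := geometric_hahn_banach_closed_point hS hclosed hnot
  have hlim : Tendsto (fun n => f (Zseq n)) atTop (nhds (f Z)) := by
    have h (V : L2) : (⟪V, (InnerProductSpace.toDual ℝ L2).symm f⟫ : ℝ) = f V := by
      rw [real_inner_comm, InnerProductSpace.toDual_symm_apply]
    simpa only [h] using hZ ((InnerProductSpace.toDual ℝ L2).symm f)
  have hle : f Z ≤ u := le_of_tendsto hlim (hr.mono fun n hn => (hfS _ hn).le)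
  exact hfZ.not_ge hle

/-- Domination tested against a convex Lipschitz function passes to the limit. -/
lemma integral_convex_comp_le {ψ : ℝ → ℝ} {c : ℝ≥0} (hψ : LipschitzWith c ψ)
    (hconv : ConvexOn ℝ univ ψ) {Zseq Fseq : ℕ → L2} {Z F : L2} (hZ : WeakConv Zseq Z)
    (hF : Tendsto (fun n => ∫ m, |Fseq n m - F m| ∂mu) atTop (nhds 0))
    (hle : ∀ n, ∫ m, ψ (Zseq n m) ∂mu ≤ ∫ m, ψ (Fseq n m) ∂mu) :
    ∫ m, ψ (Z m) ∂mu ≤ ∫ m, ψ (F m) ∂mu := by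
  refine le_of_forall_pos_le_add fun ε hε => ?_
  refine integral_convex_comp_le_of_weakConv hψ hconv hZ ?_
  have hlim : Tendsto (fun n => c * ∫ m, |Fseq n m - F m| ∂mu) atTop (nhds 0) := by
    simpa using hF.const_mul (c : ℝ)
  filter_upwards [hlim.eventually_le_const hε] with n hn
  have hintegrable : Integrable (fun m => |Fseq n m - F m|) mu :=
    (((Lp.memLp (Fseq n)).sub (Lp.memLp F)).integrable (by norm_num)).abs
  calc _ ≤ ∫ m, ψ (Fseq n m) ∂mu := hle n
    _ ≤ ∫ m, (ψ (F m) + c * |Fseq n m - F m|) ∂mu := by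
      refine integral_mono (integrable_lipschitz_comp hψ _)
        ((integrable_lipschitz_comp hψ F).add (hintegrable.const_mul _)) fun m => ?_
      have := hψ.le_add_mul (Fseq n m) (F m)
      rwa [Real.dist_eq] at this
    _ = ∫ m, ψ (F m) ∂mu + c * ∫ m, |Fseq n m - F m| ∂mu := by
      rw [integral_add (integrable_lipschitz_comp hψ F) (hintegrable.const_mul _), integral_const_mul]
    _ ≤ _ := by gcongr

/-- The Pasch–Hausdorff (Lipschitz) regularization of `φ`. -/
def lipReg (φ : ℝ → ℝ≥0∞) (c : ℝ≥0) (x : ℝ) : ℝ≥0∞ := ⨅ y, φ y + c * edist x y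

lemma lipReg_le (φ : ℝ → ℝ≥0∞) (c : ℝ≥0) (x : ℝ) : lipReg φ c x ≤ φ x :=
  (iInf_le _ x).trans (by simp)

lemma lipReg_mono (φ : ℝ → ℝ≥0∞) (x : ℝ) : Monotone fun c => lipReg φ c x := fun c d hcd => by
  refine iInf_mono fun y => ?_
  gcongr

lemma lipReg_ne_top {φ : ℝ → ℝ≥0∞} {y : ℝ} (hy : φ y ≠ ∞) (c : ℝ≥0) (x : ℝ) :
    lipReg φ c x ≠ ∞ :=
  ne_top_of_le_ne_top (ENNReal.add_ne_top.2 ⟨hy, ENNReal.mul_ne_top (by simp) (edist_ne_top _ _)⟩)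
    (iInf_le _ y)

lemma lipReg_le_add (φ : ℝ → ℝ≥0∞) (c : ℝ≥0) (x x' : ℝ) :
    lipReg φ c x ≤ lipReg φ c x' + c * edist x x' := by
  unfold lipReg
  rw [ENNReal.iInf_add]
  refine iInf_mono fun y => ?_
  rw [add_assoc, ← mul_add, add_comm (edist x' y)]
  gcongr
  exact edist_triangle _ _ _

lemma lipschitzWith_toReal_lipReg {φ : ℝ → ℝ≥0∞} {y : ℝ} (hy : φ y ≠ ∞) (c : ℝ≥0) :
    LipschitzWith c fun x => (lipReg φ c x).toReal := by
  refine LipschitzWith.of_le_add_mul c fun x x' => ?_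
  have hm : (c : ℝ≥0∞) * edist x x' ≠ ∞ := ENNReal.mul_ne_top (by simp) (edist_ne_top _ _)
  have h := ENNReal.toReal_mono (ENNReal.add_ne_top.2 ⟨lipReg_ne_top hy c x', hm⟩)
    (lipReg_le_add φ c x x')
  rwa [ENNReal.toReal_add (lipReg_ne_top hy c x') hm, ENNReal.toReal_mul, ENNReal.coe_toReal,
    edist_dist, ENNReal.toReal_ofReal dist_nonneg] at h

lemma lipReg_convex {φ : ℝ → ℝ≥0∞}
    (hφ : ∀ x y : ℝ, ∀ a b : ℝ≥0, a + b = 1 →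
      φ ((a : ℝ) * x + (b : ℝ) * y) ≤ (a : ℝ≥0∞) * φ x + (b : ℝ≥0∞) * φ y)
    (c : ℝ≥0) (x y : ℝ) (a b : ℝ≥0) (hab : a + b = 1) :
    lipReg φ c ((a : ℝ) * x + (b : ℝ) * y) ≤
      (a : ℝ≥0∞) * lipReg φ c x + (b : ℝ≥0∞) * lipReg φ c y := by
  conv_rhs => unfold lipReg
  rw [ENNReal.mul_iInf (by simp), ENNReal.mul_iInf (by simp)]
  refine ENNReal.le_iInf_add_iInf fun z w => ?_
  have hd : edist ((a : ℝ) * x + (b : ℝ) * y) ((a : ℝ) * z + (b : ℝ) * w) ≤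
      a * edist x z + b * edist y w := by
    refine (edist_add_add_le _ _ _ _).trans_eq ?_
    have hs : ∀ (t : ℝ≥0) (p q : ℝ), edist ((t : ℝ) * p) ((t : ℝ) * q) = t * edist p q := by
      intro t p q
      have := edist_smul₀ (t : ℝ) p q
      simpa [ENNReal.smul_def] using this
    rw [hs, hs]
  calc lipReg φ c ((a : ℝ) * x + (b : ℝ) * y)
      ≤ φ ((a : ℝ) * z + (b : ℝ) * w) +
        c * edist ((a : ℝ) * x + (b : ℝ) * y) ((a : ℝ) * z + (b : ℝ) * w) := iInf_le _ _
    _ ≤ (a * φ z + b * φ w) + c * (a * edist x z + b * edist y w) := by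
      gcongr
      exact hφ z w a b hab
    _ = _ := by ring

lemma tendsto_lipReg {φ : ℝ → ℝ≥0∞} (hφ : LowerSemicontinuous φ) (x : ℝ) :
    Tendsto (fun n : ℕ => lipReg φ n x) atTop (nhds (φ x)) := by
  refine tendsto_order.2 ⟨fun a ha => ?_, fun a ha =>
    Eventually.of_forall fun n => (lipReg_le φ n x).trans_lt ha⟩
  obtain ⟨b, hab, hb⟩ := exists_between ha
  obtain ⟨δ, hδ, hball⟩ := Metric.eventually_nhds_iff.1 (hφ x b hb)
  have hb_top : b ≠ ∞ := (hb.trans_le le_top).ne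
  obtain ⟨N, hN⟩ := ENNReal.exists_nat_mul_gt (ENNReal.ofReal_pos.2 hδ).ne' hb_top
  filter_upwards [eventually_ge_atTop N] with n hn
  refine hab.trans_le (le_iInf fun y => ?_)
  by_cases hy : dist y x < δ
  · exact (hball hy).le.trans le_self_add
  · refine le_trans ?_ le_add_self
    refine hN.le.trans ?_
    rw [edist_comm, edist_dist]
    have : (N : ℝ≥0∞) ≤ ((n : ℝ≥0) : ℝ≥0∞) := by exact_mod_cast hn
    gcongr
    exact not_lt.1 hy

/-- Closedness of the convex order under weak and strong `L¹` convergence. -/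
lemma dominated_of_tendsto {Zseq Fseq : ℕ → L2} {Z F : L2} (hZ : WeakConv Zseq Z)
    (hF : Tendsto (fun n => ∫ m, |Fseq n m - F m| ∂mu) atTop (nhds 0))
    (hdom : ∀ n, Dominated (Zseq n) (Fseq n)) : Dominated Z F := by
  intro φ hlsc hconv
  by_cases htop : ∀ y, φ y = ∞
  · simp [htop]
  push Not at htop
  obtain ⟨y, hy⟩ := htop
  have hlip := fun c : ℝ≥0 => lipschitzWith_toReal_lipReg hy c
  have hofReal : ∀ c x, ENNReal.ofReal (lipReg φ c x).toReal = lipReg φ c x :=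
    fun c x => ENNReal.ofReal_toReal (lipReg_ne_top hy c x)
  have hcont : ∀ c, Continuous (lipReg φ c) := fun c => by
    have := ENNReal.continuous_ofReal.comp (hlip c).continuous
    simpa only [Function.comp_def, hofReal] using this
  have hlint : ∀ (c : ℝ≥0) (V : L2), ∫⁻ m, lipReg φ c (V m) ∂mu =
      ENNReal.ofReal (∫ m, (lipReg φ c (V m)).toReal ∂mu) := fun c V => by
    rw [ofReal_integral_eq_lintegral_ofReal (integrable_lipschitz_comp (hlip c) V)
      (Eventually.of_forall fun m => ENNReal.toReal_nonneg)]
    simp only [hofReal]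
  have hreal : ∀ c : ℝ≥0, ConvexOn ℝ univ fun x => (lipReg φ c x).toReal := fun c => by
    refine ⟨convex_univ, fun p _ q _ a b ha hb hab => ?_⟩
    lift a to ℝ≥0 using ha
    lift b to ℝ≥0 using hb
    have hp : (a : ℝ≥0∞) * lipReg φ c p ≠ ∞ := ENNReal.mul_ne_top (by simp) (lipReg_ne_top hy c p)
    have hq : (b : ℝ≥0∞) * lipReg φ c q ≠ ∞ := ENNReal.mul_ne_top (by simp) (lipReg_ne_top hy c q)
    have h := ENNReal.toReal_mono (ENNReal.add_ne_top.2 ⟨hp, hq⟩)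
      (lipReg_convex hconv c p q a b (by exact_mod_cast hab))
    rwa [ENNReal.toReal_add hp hq, ENNReal.toReal_mul, ENNReal.toReal_mul] at h
  have hmain : ∀ c : ℝ≥0, ∫⁻ m, lipReg φ c (Z m) ∂mu ≤ ∫⁻ m, φ (F m) ∂mu := fun c => by
    refine le_trans ?_ (lintegral_mono fun m => lipReg_le φ c (F m))
    rw [hlint, hlint]
    refine ENNReal.ofReal_le_ofReal (integral_convex_comp_le (hlip c) (hreal c) hZ hF fun n => ?_)
    have h := hdom n _ (hcont c).lowerSemicontinuous (lipReg_convex hconv c)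
    rw [hlint, hlint] at h
    exact (ENNReal.ofReal_le_ofReal_iff (integral_nonneg fun m => ENNReal.toReal_nonneg)).1 h
  refine le_of_tendsto' (lintegral_tendsto_of_tendsto_of_monotone
    (f := fun (n : ℕ) m => lipReg φ n (Z m)) (fun n => ?_) ?_ ?_) fun n => hmain n
  · exact (hcont n).measurable.comp_aemeasurable (Lp.aestronglyMeasurable Z).aemeasurable
  · exact Eventually.of_forall fun m i j hij =>
      lipReg_mono φ (Z m) (by exact_mod_cast hij : (i : ℝ≥0) ≤ j)
  · exact Eventually.of_forall fun m => tendsto_lipReg hlsc (Z m)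

/-- **Closure lemma.** If `X_n ∈ K`, `Z_n − F_n ∈ H_{X_n}^⊥`, `X_n → X`
strongly with `X ∈ K`, and `Z_n ⇀ Z`, `F_n ⇀ F` weakly in `L²(Ω)`, then
`Z − F ∈ H_X^⊥`; if moreover `Z_n ≺ F_n` and `F_n → F` strongly in `L¹(Ω)` then
`Z ≺ F`. -/
theorem stmt17 (Xseq : ℕ → L2) (Zseq Fseq : ℕ → L2)
    (hXK : ∀ n, Xseq n ∈ Kcone)
    (hperp : ∀ n, Zseq n - Fseq n ∈ HXperp (Xseq n))
    (X : L2) (hX : X ∈ Kcone)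
    (hXconv : Tendsto Xseq atTop (nhds X))
    (Z Fl : L2)
    (hZconv : WeakConv Zseq Z) (hFconv : WeakConv Fseq Fl) :
    Z - Fl ∈ HXperp X ∧
    ((∀ n, Dominated (Zseq n) (Fseq n)) →
      Tendsto (fun n => ∫ m, |Fseq n m - Fl m| ∂mu) atTop (nhds 0) →
      Dominated Z Fl) := by
  refine ⟨sub_mem_HXperp_of_tendsto hXK hperp hX hXconv fun G => ?_,
    fun hdom hF => dominated_of_tendsto hZconv hF hdom⟩
  simpa only [inner_sub_left] using (hZconv G).sub (hFconv G)
end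
end
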